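/- Let Γ be a groupoid and R an object unital Γ-graded ring. The following are equivalent: (1) R is a gr-simple pfm ring; (2) R is a gr-prime pfm ring; (3) there exist e₀, e ∈ Γ₀, a Γ-graded division ring D with supp(D) ⊆ e₀Γe₀, a nonempty set I and a d-finite sequence σ̄ = (σ_i)_{i∈I} of elements of e₀Γ such that R ≅_gr M_I(D)(σ̄) and exactly one i ∈ I satisfies d(σ_i) = e; (4) R is a gr-simple ring and there exists e ∈ Γ₀ such that R(e) is a gr-simple right R-module; (5) R is a gr-simple Γ₀-artinian ring and there exists e ∈ Γ₀ such that R_e is a division ring. -/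

import Mathlib

set_option autoImplicit false

noncomputable section

universe u v w x y

/-- A groupoid structure on its set `Γ` of morphisms.  Objects are identified with
the identity morphisms: `src γ` and `tgt γ` are the source and target identities
(`d(γ)` and `r(γ)`), and `comp γ δ h` is the composite `γδ`, which is defined
exactly when `src γ = tgt δ`. -/
structure Gpd (Γ : Type u) where
  src : Γ → Γ
  tgt : Γ → Γ
  inv : Γ → Γ
  comp : (γ δ : Γ) → src γ = tgt δ → Γ
  src_src : ∀ γ, src (src γ) = src γ
  tgt_src : ∀ γ, tgt (src γ) = src γ
  src_tgt : ∀ γ, src (tgt γ) = tgt γ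
  tgt_tgt : ∀ γ, tgt (tgt γ) = tgt γ
  src_comp : ∀ γ δ (h : src γ = tgt δ), src (comp γ δ h) = src δ
  tgt_comp : ∀ γ δ (h : src γ = tgt δ), tgt (comp γ δ h) = tgt γ
  comp_id : ∀ γ, comp γ (src γ) (tgt_src γ).symm = γ
  id_comp : ∀ γ, comp (tgt γ) γ (src_tgt γ) = γ
  comp_assoc : ∀ γ δ ε (h₁ : src γ = tgt δ) (h₂ : src δ = tgt ε),
    comp (comp γ δ h₁) ε ((src_comp γ δ h₁).trans h₂)
      = comp γ (comp δ ε h₂) (h₁.trans (tgt_comp δ ε h₂).symm)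
  src_inv : ∀ γ, src (inv γ) = tgt γ
  tgt_inv : ∀ γ, tgt (inv γ) = src γ
  inv_inv : ∀ γ, inv (inv γ) = γ
  comp_inv : ∀ γ, comp γ (inv γ) (tgt_inv γ).symm = tgt γ
  inv_comp : ∀ γ, comp (inv γ) γ (src_inv γ) = src γ

namespace Gpd

variable {Γ : Type u} (G : Gpd Γ)

/-- `e` is an object of the groupoid, i.e. an identity morphism. -/
def IsObj (e : Γ) : Prop := G.src e = e

open scoped Classical in
/-- Partial composition: `some (γδ)` when defined, `none` otherwise. -/
def mul? (γ δ : Γ) : Option Γ :=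
  if h : G.src γ = G.tgt δ then some (G.comp γ δ h) else none

/-- The partial triple product `σ γ τ⁻¹`, `none` when undefined. -/
def conj? (σ γ τ : Γ) : Option Γ :=
  (G.mul? σ γ).bind fun η => G.mul? η (G.inv τ)

end Gpd

/-- An object unital `Γ`-graded ring structure on the (possibly non-unital) ring `R`:
a decomposition `R = ⊕ R_γ` with `R_γ R_δ ⊆ R_{γδ}` (zero when `γδ` is undefined),
together with local units `1_e ∈ R_e` for the objects `e` such that
`1_{r(γ)} a = a 1_{d(γ)} = a` for homogeneous `a` of degree `γ`. -/
structure GammaRing {Γ : Type u} (G : Gpd Γ) (R : Type v) [NonUnitalRing R] where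
  grade : Γ → AddSubgroup R
  grade_iSup : (⨆ γ : Γ, grade γ) = ⊤
  grade_indep : ∀ γ : Γ, grade γ ⊓ (⨆ (δ : Γ) (_ : δ ≠ γ), grade δ) = ⊥
  mul_mem : ∀ (γ δ : Γ) (h : G.src γ = G.tgt δ) (a b : R),
    a ∈ grade γ → b ∈ grade δ → a * b ∈ grade (G.comp γ δ h)
  mul_ne : ∀ (γ δ : Γ), G.src γ ≠ G.tgt δ → ∀ (a b : R),
    a ∈ grade γ → b ∈ grade δ → a * b = 0
  one : Γ → R
  one_mem : ∀ e : Γ, G.IsObj e → one e ∈ grade e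
  one_mul' : ∀ (γ : Γ) (a : R), a ∈ grade γ → one (G.tgt γ) * a = a
  mul_one' : ∀ (γ : Γ) (a : R), a ∈ grade γ → a * one (G.src γ) = a

/-- A (unital) `Γ`-graded right module over the object unital `Γ`-graded ring `RG`. -/
structure GammaMod {Γ : Type u} {G : Gpd Γ} {R : Type v} [NonUnitalRing R]
    (RG : GammaRing G R) (M : Type w) [AddCommGroup M] where
  smul : M → R → M
  smul_add : ∀ (m : M) (a b : R), smul m (a + b) = smul m a + smul m b
  add_smul : ∀ (m n : M) (a : R), smul (m + n) a = smul m a + smul n a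
  smul_mul : ∀ (m : M) (a b : R), smul m (a * b) = smul (smul m a) b
  grade : Γ → AddSubgroup M
  grade_iSup : (⨆ γ : Γ, grade γ) = ⊤
  grade_indep : ∀ γ : Γ, grade γ ⊓ (⨆ (δ : Γ) (_ : δ ≠ γ), grade δ) = ⊥
  smul_mem : ∀ (σ τ : Γ) (h : G.src σ = G.tgt τ) (m : M) (a : R),
    m ∈ grade σ → a ∈ RG.grade τ → smul m a ∈ grade (G.comp σ τ h)
  smul_ne : ∀ (σ τ : Γ), G.src σ ≠ G.tgt τ → ∀ (m : M) (a : R),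
    m ∈ grade σ → a ∈ RG.grade τ → smul m a = 0
  smul_one : ∀ (σ : Γ) (m : M), m ∈ grade σ → smul m (RG.one (G.src σ)) = m

/-- A (unital) `Γ`-graded left module over the object unital `Γ`-graded ring `RG`. -/
structure GammaLMod {Γ : Type u} {G : Gpd Γ} {R : Type v} [NonUnitalRing R]
    (RG : GammaRing G R) (M : Type w) [AddCommGroup M] where
  smul : R → M → M
  smul_add : ∀ (a : R) (m n : M), smul a (m + n) = smul a m + smul a n
  add_smul : ∀ (a b : R) (m : M), smul (a + b) m = smul a m + smul b m
  mul_smul : ∀ (a b : R) (m : M), smul (a * b) m = smul a (smul b m)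
  grade : Γ → AddSubgroup M
  grade_iSup : (⨆ γ : Γ, grade γ) = ⊤
  grade_indep : ∀ γ : Γ, grade γ ⊓ (⨆ (δ : Γ) (_ : δ ≠ γ), grade δ) = ⊥
  smul_mem : ∀ (τ σ : Γ) (h : G.src τ = G.tgt σ) (a : R) (m : M),
    a ∈ RG.grade τ → m ∈ grade σ → smul a m ∈ grade (G.comp τ σ h)
  smul_ne : ∀ (τ σ : Γ), G.src τ ≠ G.tgt σ → ∀ (a : R) (m : M),
    a ∈ RG.grade τ → m ∈ grade σ → smul a m = 0
  one_smul : ∀ (σ : Γ) (m : M), m ∈ grade σ → smul (RG.one (G.tgt σ)) m = m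

namespace GammaMod

variable {Γ : Type u} {G : Gpd Γ} {R : Type v} [NonUnitalRing R] {RG : GammaRing G R}
  {M : Type w} [AddCommGroup M] (Mod : GammaMod RG M)

/-- `shiftGrade σ γ` is the homogeneous component `M_{σγ}` (zero when undefined):
the degree-`γ` component of the shifted module `M(σ)`. -/
def shiftGrade (σ γ : Γ) : AddSubgroup M := (G.mul? σ γ).elim ⊥ Mod.grade

/-- `N` is a graded submodule of `M`. -/
def IsGradedSub (N : AddSubgroup M) : Prop :=
  (∀ m ∈ N, ∀ a : R, Mod.smul m a ∈ N) ∧ N ≤ ⨆ γ : Γ, (Mod.grade γ ⊓ N)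

/-- `N` is a gr-simple graded submodule of `M`. -/
def IsGrSimpleSub (N : AddSubgroup M) : Prop :=
  Mod.IsGradedSub N ∧ N ≠ ⊥ ∧
    ∀ P : AddSubgroup M, Mod.IsGradedSub P → P ≤ N → P = ⊥ ∨ P = N

/-- `M` is a gr-simple graded module. -/
def IsGrSimple : Prop := Mod.IsGrSimpleSub ⊤

/-- `M` is a gr-semisimple graded module: it is the sum of its gr-simple graded
submodules. -/
def IsGrSemisimple : Prop :=
  (⨆ (N : AddSubgroup M) (_ : Mod.IsGrSimpleSub N), N) = ⊤

/-- The submodule `M(e) = ⊕_{r(γ) = e} M_γ`. -/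
def eComp (e : Γ) : AddSubgroup M := ⨆ (γ : Γ) (_ : G.tgt γ = e), Mod.grade γ

/-- `M` is `Γ₀`-artinian: each `M(e)` satisfies the descending chain condition on
graded submodules. -/
def IsGamma0Artinian : Prop :=
  ∀ e : Γ, G.IsObj e → ∀ f : ℕ → AddSubgroup M,
    (∀ n, Mod.IsGradedSub (f n) ∧ f n ≤ Mod.eComp e) →
    (∀ n, f (n + 1) ≤ f n) → ∃ n, ∀ k, n ≤ k → f k = f n

/-- `M` is a (nonzero) `Γ₀`-simple module: `M(e)` is gr-simple for every `e ∈ Γ'₀(M)`. -/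
def IsGamma0Simple : Prop :=
  (∃ m : M, m ≠ 0) ∧
    ∀ e : Γ, G.IsObj e → Mod.eComp e ≠ ⊥ → Mod.IsGrSimpleSub (Mod.eComp e)

theorem isGradedSub_top : Mod.IsGradedSub (⊤ : AddSubgroup M) := by
  constructor
  · intro m _ a
    exact AddSubgroup.mem_top _
  · have h : (⨆ γ : Γ, (Mod.grade γ ⊓ (⊤ : AddSubgroup M))) = (⊤ : AddSubgroup M) := by
      simp [Mod.grade_iSup]
    rw [h]

/-- `HomGrade γ` is the homogeneous component `HOM_R(M,M)_γ` of the graded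
endomorphism ring `END_R(M)`: the `R`-linear additive endomorphisms `g` with
`g(M_σ) ⊆ M_{γσ}` for all `σ`. -/
def HomGrade (γ : Γ) : Set (M →+ M) :=
  {g | (∀ (m : M) (a : R), g (Mod.smul m a) = Mod.smul (g m) a) ∧
       ∀ (σ : Γ) (m : M), m ∈ Mod.grade σ → g m ∈ Mod.shiftGrade γ σ}

/-- The graded submodule `N` of `M` is gr-isomorphic to a shift of the graded
submodule `N'` of `M₂`: there are `σ ∈ Γ` and a gr-isomorphism `N ≅ N'(σ)`. -/
def SubIso {M₂ : Type x} [AddCommGroup M₂] (Mod₂ : GammaMod RG M₂)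
    (N : AddSubgroup M) (N' : AddSubgroup M₂) (hN : Mod.IsGradedSub N) : Prop :=
  ∃ (σ : Γ) (ψ : N ≃+ N'),
    (∀ (n : N) (a : R),
      ((ψ ⟨Mod.smul n.1 a, hN.1 n.1 n.2 a⟩ : N') : M₂) = Mod₂.smul ((ψ n : N') : M₂) a) ∧
    ∀ γ : Γ, (fun n : N => ((ψ n : N') : M₂)) '' {n : N | (n : M) ∈ Mod.grade γ}
      = {m : M₂ | m ∈ N' ∧ m ∈ Mod₂.shiftGrade σ γ}

variable {ι : Type y}

/-- A pseudo-linearly independent sequence of homogeneous elements. -/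
def PseudoLI (β : ι → Γ) (v : ι → M) : Prop :=
  (∀ i, v i ∈ Mod.grade (β i) ∧ v i ≠ 0) ∧
  ∀ a : ι →₀ R, (∀ i, RG.one (G.src (β i)) * a i = a i) →
    (a.sum fun i r => Mod.smul (v i) r) = 0 → a = 0

/-- A pseudo-basis of `M`: a generating pseudo-linearly independent sequence of
homogeneous elements. -/
def PseudoBasis (β : ι → Γ) (v : ι → M) : Prop :=
  Mod.PseudoLI β v ∧
    AddSubgroup.closure {m : M | ∃ (i : ι) (r : R), m = Mod.smul (v i) r} = ⊤

/-- `M` is pseudo-free: it has a pseudo-basis. -/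
def PseudoFree : Prop :=
  ∃ (κ : Type (max u w)) (β : κ → Γ) (v : κ → M), Mod.PseudoBasis β v

end GammaMod

namespace GammaLMod

variable {Γ : Type u} {G : Gpd Γ} {R : Type v} [NonUnitalRing R] {RG : GammaRing G R}
  {M : Type w} [AddCommGroup M] (Mod : GammaLMod RG M)

/-- `rshiftGrade σ γ` is the homogeneous component `M_{σγ}` (zero when undefined). -/
def rshiftGrade (σ γ : Γ) : AddSubgroup M := (G.mul? σ γ).elim ⊥ Mod.grade

/-- `N` is a graded left submodule of `M`. -/
def IsGradedSub (N : AddSubgroup M) : Prop :=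
  (∀ m ∈ N, ∀ a : R, Mod.smul a m ∈ N) ∧ N ≤ ⨆ γ : Γ, (Mod.grade γ ⊓ N)

def IsGrSimpleSub (N : AddSubgroup M) : Prop :=
  Mod.IsGradedSub N ∧ N ≠ ⊥ ∧
    ∀ P : AddSubgroup M, Mod.IsGradedSub P → P ≤ N → P = ⊥ ∨ P = N

def IsGrSimple : Prop := Mod.IsGrSimpleSub ⊤

def IsGrSemisimple : Prop :=
  (⨆ (N : AddSubgroup M) (_ : Mod.IsGrSimpleSub N), N) = ⊤

/-- The left submodule `(e)M = ⊕_{d(γ) = e} M_γ`. -/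
def lComp (e : Γ) : AddSubgroup M := ⨆ (γ : Γ) (_ : G.src γ = e), Mod.grade γ

def IsGamma0Artinian : Prop :=
  ∀ e : Γ, G.IsObj e → ∀ f : ℕ → AddSubgroup M,
    (∀ n, Mod.IsGradedSub (f n) ∧ f n ≤ Mod.lComp e) →
    (∀ n, f (n + 1) ≤ f n) → ∃ n, ∀ k, n ≤ k → f k = f n

/-- `V` has finite `Γ₀`-dimension: each `(e)V` has a finite pseudo-basis. -/
def FiniteGamma0Dim : Prop :=
  ∀ e : Γ, G.IsObj e → ∃ (n : ℕ) (γs : Fin n → Γ) (u : Fin n → M),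
    (∀ i, G.src (γs i) = e ∧ u i ∈ Mod.grade (γs i) ∧ u i ≠ 0) ∧
    (∀ m ∈ Mod.lComp e,
      m ∈ AddSubgroup.closure {y : M | ∃ (i : Fin n) (a : R), y = Mod.smul a (u i)}) ∧
    ∀ a : Fin n → R, (∀ i, a i * RG.one (G.tgt (γs i)) = a i) →
      (∑ i, Mod.smul (a i) (u i)) = 0 → ∀ i, a i = 0

end GammaLMod

namespace GammaRing

variable {Γ : Type u} {G : Gpd Γ} {R : Type v} [NonUnitalRing R] (RG : GammaRing G R)

/-- The (right) regular graded module `R_R`. -/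
def regular : GammaMod RG R where
  smul := fun m a => m * a
  smul_add := fun m a b => mul_add m a b
  add_smul := fun m n a => add_mul m n a
  smul_mul := fun m a b => (mul_assoc m a b).symm
  grade := RG.grade
  grade_iSup := RG.grade_iSup
  grade_indep := RG.grade_indep
  smul_mem := RG.mul_mem
  smul_ne := RG.mul_ne
  smul_one := RG.mul_one'

/-- The left regular graded module `_R R`. -/
def leftRegular : GammaLMod RG R where
  smul := fun a m => a * m
  smul_add := fun a m n => mul_add a m n
  add_smul := fun a b m => add_mul a b m
  mul_smul := fun a b m => mul_assoc a b m
  grade := RG.grade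
  grade_iSup := RG.grade_iSup
  grade_indep := RG.grade_indep
  smul_mem := RG.mul_mem
  smul_ne := RG.mul_ne
  one_smul := RG.one_mul'

/-- `I` is a graded (two-sided) ideal of `R`. -/
def IsGradedIdeal (I : AddSubgroup R) : Prop :=
  (∀ a ∈ I, ∀ r : R, a * r ∈ I ∧ r * a ∈ I) ∧ I ≤ ⨆ γ : Γ, (RG.grade γ ⊓ I)

/-- `R` is a gr-simple ring. -/
def IsGrSimpleRing : Prop :=
  (∃ a : R, a ≠ 0) ∧ ∀ I : AddSubgroup R, RG.IsGradedIdeal I → I = ⊥ ∨ I = ⊤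

/-- `R` is a gr-prime ring. -/
def IsGrPrime : Prop :=
  (∃ a : R, a ≠ 0) ∧ ∀ I J : AddSubgroup R, RG.IsGradedIdeal I → RG.IsGradedIdeal J →
    I ≠ ⊥ → J ≠ ⊥ → ∃ a ∈ I, ∃ b ∈ J, a * b ≠ 0

/-- `R` is a `Γ`-graded division ring: `R ≠ 0` and every nonzero homogeneous element
of degree `γ` has an inverse of degree `γ⁻¹`. -/
def IsGrDivision : Prop :=
  (∃ a : R, a ≠ 0) ∧ ∀ (γ : Γ) (a : R), a ∈ RG.grade γ → a ≠ 0 →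
    ∃ b ∈ RG.grade (G.inv γ), a * b = RG.one (G.tgt γ) ∧ b * a = RG.one (G.src γ)

/-- `supp(R) ⊆ eΓe`. -/
def SuppLE (e : Γ) : Prop := ∀ γ : Γ, RG.grade γ ≠ ⊥ → G.src γ = e ∧ G.tgt γ = e

def IsRightGrSemisimple : Prop := RG.regular.IsGrSemisimple

def IsLeftGrSemisimple : Prop := RG.leftRegular.IsGrSemisimple

def IsRightGamma0Artinian : Prop := RG.regular.IsGamma0Artinian

def IsLeftGamma0Artinian : Prop := RG.leftRegular.IsGamma0Artinian

/-- The component ring `R_e` is a division ring with identity `1_e`. -/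
def ComponentDivisionRing (e : Γ) : Prop :=
  RG.one e ≠ 0 ∧ ∀ a ∈ RG.grade e, a ≠ 0 →
    ∃ b ∈ RG.grade e, a * b = RG.one e ∧ b * a = RG.one e

/-- The additive subgroup `N` of `R` is, with the induced structure, a gr-simple
graded ring. -/
def SubringGrSimple (N : AddSubgroup R) : Prop :=
  N ≠ ⊥ ∧ ∀ P : AddSubgroup R,
    (P ≤ N ∧ (∀ p ∈ P, ∀ n ∈ N, p * n ∈ P ∧ n * p ∈ P) ∧
      P ≤ ⨆ γ : Γ, (RG.grade γ ⊓ P)) →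
    P = ⊥ ∨ P = N

/-- The additive subgroup `N` of `R` is, with the induced structure, a gr-prime
graded ring. -/
def SubringGrPrime (N : AddSubgroup R) : Prop :=
  (∃ a ∈ N, a ≠ 0) ∧ ∀ P Q : AddSubgroup R,
    (P ≤ N ∧ (∀ p ∈ P, ∀ n ∈ N, p * n ∈ P ∧ n * p ∈ P) ∧
      P ≤ ⨆ γ : Γ, (RG.grade γ ⊓ P)) →
    (Q ≤ N ∧ (∀ q ∈ Q, ∀ n ∈ N, q * n ∈ Q ∧ n * q ∈ Q) ∧
      Q ≤ ⨆ γ : Γ, (RG.grade γ ⊓ Q)) →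
    P ≠ ⊥ → Q ≠ ⊥ → ∃ p ∈ P, ∃ q ∈ Q, p * q ≠ 0

/-- The additive subgroup `N` of `R` is, with the induced structure, a graded
division ring. -/
def SubringGrDivision (N : AddSubgroup R) : Prop :=
  (∃ a ∈ N, a ≠ 0) ∧ ∀ (γ : Γ) (a : R), a ∈ RG.grade γ → a ∈ N → a ≠ 0 →
    RG.one (G.tgt γ) ∈ N ∧ RG.one (G.src γ) ∈ N ∧
    ∃ b ∈ RG.grade (G.inv γ), b ∈ N ∧ a * b = RG.one (G.tgt γ) ∧ b * a = RG.one (G.src γ)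

/-- The additive subgroup `N` of `R` is, with the induced structure, a right
`Γ₀`-artinian graded ring. -/
def SubringRightGamma0Artinian (N : AddSubgroup R) : Prop :=
  ∀ e : Γ, G.IsObj e → ∀ f : ℕ → AddSubgroup R,
    (∀ n, f n ≤ N ⊓ RG.regular.eComp e ∧ (∀ p ∈ f n, ∀ x ∈ N, p * x ∈ f n) ∧
      f n ≤ ⨆ γ : Γ, (RG.grade γ ⊓ f n)) →
    (∀ n, f (n + 1) ≤ f n) → ∃ n, ∀ k, n ≤ k → f k = f n

end GammaRing

/-- A bundled object unital `Γ`-graded ring. -/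
structure BRing.{u', v'} {Γ : Type u'} (G : Gpd Γ) where
  carrier : Type v'
  [ring : NonUnitalRing carrier]
  str : GammaRing G carrier

attribute [instance] BRing.ring

/-- A bundled `Γ`-graded right module over `RG`. -/
structure BMod.{u', v', w'} {Γ : Type u'} {G : Gpd Γ} {R : Type v'} [NonUnitalRing R]
    (RG : GammaRing G R) where
  carrier : Type w'
  [acg : AddCommGroup carrier]
  str : GammaMod RG carrier

attribute [instance] BMod.acg

/-- Two bundled graded modules are in the same isoshift class. -/
def BModSameClass {Γ : Type u} {G : Gpd Γ} {R : Type v} [NonUnitalRing R]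
    {RG : GammaRing G R} (S T : BMod.{u, v, w} RG) : Prop :=
  S.str.SubIso T.str ⊤ ⊤ S.str.isGradedSub_top

/-- The isoshiftical component of `R` of the type of the graded module `S`:
the sum of all graded right ideals of `R` which are gr-simple and lie in the
isoshift class of `S`. -/
def GammaRing.isoComponent {Γ : Type u} {G : Gpd Γ} {R : Type v} [NonUnitalRing R]
    (RG : GammaRing G R) (S : BMod.{u, v, w} RG) : AddSubgroup R :=
  ⨆ (N : AddSubgroup R) (_ : RG.regular.IsGrSimpleSub N ∧
      ∃ hN : RG.regular.IsGradedSub N, RG.regular.SubIso S.str N ⊤ hN), N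

/-- `R` is a pseudo-free module ring: every `Γ`-graded right `R`-module is
pseudo-free. -/
def GammaRing.IsPfm.{u', v', w'} {Γ : Type u'} {G : Gpd Γ} {R : Type v'}
    [NonUnitalRing R] (RG : GammaRing G R) : Prop :=
  ∀ S : BMod.{u', v', w'} RG, S.str.PseudoFree

/-- `R` has invariant pseudo-basis number: any two pseudo-bases of a finitely
generated pseudo-free graded module have the same number of elements. -/
def GammaRing.IPBN.{u', v', w'} {Γ : Type u'} {G : Gpd Γ} {R : Type v'}
    [NonUnitalRing R] (RG : GammaRing G R) : Prop :=
  ∀ (S : BMod.{u', v', w'} RG) (m n : ℕ) (β₁ : Fin m → Γ) (v₁ : Fin m → S.carrier)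
    (β₂ : Fin n → Γ) (v₂ : Fin n → S.carrier),
    S.str.PseudoBasis β₁ v₁ → S.str.PseudoBasis β₂ v₂ → m = n

/-- A `d`-finite sequence of elements of `eΓ`. -/
def DFiniteSeq {Γ : Type u} (G : Gpd Γ) {I : Type w} (e : Γ) (σ : I → Γ) : Prop :=
  (∀ i, G.tgt (σ i) = e) ∧ ∀ f : Γ, {i : I | G.src (σ i) = f}.Finite

/-- The degree-`γ` constraint on the `(i,j)` entry of a homogeneous matrix:
the component `D_{σ_i γ σ_j⁻¹}` (zero when the product is undefined). -/
def entryGrade {Γ : Type u} (G : Gpd Γ) {D : Type v} [NonUnitalRing D]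
    (DG : GammaRing G D) {I : Type w} (σ : I → Γ) (γ : Γ) (i j : I) : AddSubgroup D :=
  (G.conj? (σ i) γ (σ j)).elim ⊥ DG.grade

/-- The `(i,j)` entry of the product of two finitely supported matrices. -/
def matMulEntry {I : Type w} {D : Type v} [NonUnitalRing D]
    (A B : I →₀ I →₀ D) (i j : I) : D :=
  (A i).sum fun k a => a * B k j

/-- `R` is gr-isomorphic to the graded matrix ring `M_I(D)(σ̄)`: there is an
injective additive map from `R` to the finitely supported `I×I` matrices over `D`
which respects matrix multiplication and maps the homogeneous component `R_γ` onto
the set of homogeneous matrices of degree `γ`. -/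
def GammaRing.GrRepMatrix {Γ : Type u} {G : Gpd Γ} {R : Type v} {D : Type x}
    [NonUnitalRing R] [NonUnitalRing D] (RG : GammaRing G R) (DG : GammaRing G D)
    {I : Type w} (σ : I → Γ) : Prop :=
  ∃ φ : R →+ (I →₀ I →₀ D), Function.Injective φ ∧
    (∀ (a b : R) (i j : I), φ (a * b) i j = matMulEntry (φ a) (φ b) i j) ∧
    ∀ γ : Γ, (fun r : R => φ r) '' (RG.grade γ : Set R)
      = {m : I →₀ I →₀ D | ∀ i j : I, m i j ∈ entryGrade G DG σ γ i j}

/-- Entry constraint for matrix rings indexed by a sequence of subsets of `Γ`: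
the component `D_{Σ_i γ Σ_j⁻¹}`. -/
def entryGradeSet {Γ : Type u} (G : Gpd Γ) {D : Type v} [NonUnitalRing D]
    (DG : GammaRing G D) {I : Type w} (Sig : I → Set Γ) (γ : Γ) (i j : I) :
    AddSubgroup D :=
  ⨆ (σ : Γ) (_ : σ ∈ Sig i) (τ : Γ) (_ : τ ∈ Sig j), (G.conj? σ γ τ).elim ⊥ DG.grade

/-- `R` is gr-isomorphic to the graded matrix ring `M_I(D)(Σ̄)` for a sequence of
subsets `Σ̄`. -/
def GammaRing.GrRepMatrixSet {Γ : Type u} {G : Gpd Γ} {R : Type v} {D : Type x}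
    [NonUnitalRing R] [NonUnitalRing D] (RG : GammaRing G R) (DG : GammaRing G D)
    {I : Type w} (Sig : I → Set Γ) : Prop :=
  ∃ φ : R →+ (I →₀ I →₀ D), Function.Injective φ ∧
    (∀ (a b : R) (i j : I), φ (a * b) i j = matMulEntry (φ a) (φ b) i j) ∧
    ∀ γ : Γ, (fun r : R => φ r) '' (RG.grade γ : Set R)
      = {m : I →₀ I →₀ D | ∀ i j : I, m i j ∈ entryGradeSet G DG Sig γ i j}

/-- The family of graded rings `Rj` is summable. -/
def SummableFam {Γ : Type u} {G : Gpd Γ} {J : Type w} (Rj : J → BRing.{u, x} G) : Prop :=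
  ∀ e : Γ, G.IsObj e → {j : J | (Rj j).str.grade e ≠ ⊥}.Finite

/-- `P` (with projections `π`) is the graded direct product `∏^gr_j R_j`. -/
def IsGradedProductB {Γ : Type u} {G : Gpd Γ} {J : Type w} (Rj : J → BRing.{u, x} G)
    {P : Type v} [NonUnitalRing P] (PG : GammaRing G P)
    (π : ∀ j, P →+ (Rj j).carrier) : Prop :=
  (∀ (j : J) (a b : P), π j (a * b) = π j a * π j b) ∧
  (∀ (j : J) (e : Γ), G.IsObj e → π j (PG.one e) = (Rj j).str.one e) ∧
  ∀ (γ : Γ) (xs : ∀ j, (Rj j).carrier), (∀ j, xs j ∈ (Rj j).str.grade γ) →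
    ∃! p : P, p ∈ PG.grade γ ∧ ∀ j, π j p = xs j

/-- `R` and `S` are gr-isomorphic graded rings. -/
def GrIso {Γ : Type u} {G : Gpd Γ} {R : Type v} {S : Type x}
    [NonUnitalRing R] [NonUnitalRing S] (RG : GammaRing G R) (SG : GammaRing G S) :
    Prop :=
  ∃ φ : R ≃+ S, (∀ a b : R, φ (a * b) = φ a * φ b) ∧
    (∀ e : Γ, G.IsObj e → φ (RG.one e) = SG.one e) ∧
    ∀ γ : Γ, (fun a : R => φ a) '' (RG.grade γ : Set R) = (SG.grade γ : Set S)

/-- The gr-primality relation: `1_e D 1_f ≠ 0`. -/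
def GrPrimRel {Γ : Type u} (G : Gpd Γ) {D : Type v} [NonUnitalRing D]
    (DG : GammaRing G D) (e f : Γ) : Prop :=
  ∃ x : D, DG.one e * x * DG.one f ≠ 0

/-- The graded ideal `D_{[e]}` attached to the `∼`-class of `e`. -/
def ClassIdeal {Γ : Type u} (G : Gpd Γ) {D : Type v} [NonUnitalRing D]
    (DG : GammaRing G D) (e : Γ) : AddSubgroup D :=
  ⨆ (γ : Γ) (_ : GrPrimRel G DG (G.tgt γ) e ∧ GrPrimRel G DG (G.src γ) e), DG.grade γ

end
universe u v w x y

section GradedFamily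

variable {ι : Type*} {M : Type*} [AddCommGroup M] {A : ι → AddSubgroup M}

/-- An independent spanning family of subgroups admits a family of projections. -/
theorem exists_gradedProj (hS : (⨆ γ, A γ) = ⊤)
    (hI : ∀ γ, A γ ⊓ (⨆ (δ) (_ : δ ≠ γ), A δ) = ⊥) :
    ∃ p : ι → M →+ M, (∀ γ m, p γ m ∈ A γ) ∧ (∀ γ, ∀ m ∈ A γ, p γ m = m) ∧
      ∀ γ δ, γ ≠ δ → ∀ m ∈ A δ, p γ m = 0 := by
  classical
  have hind : iSupIndep A := fun γ => disjoint_iff.mpr (hI γ)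
  let F : (Π₀ i, A i) →+ M := DFinsupp.sumAddHom fun i => (A i).subtype
  have hsingle : ∀ i (x : A i), F (DFinsupp.single i x) = x := fun i x => by
    simp [F]
  have hinj : Function.Injective F := hind.dfinsuppSumAddHom_injective
  have hsurj : Function.Surjective F := by
    rw [← AddMonoidHom.range_eq_top, eq_top_iff, ← hS]
    refine iSup_le fun i x hx => ⟨DFinsupp.single i ⟨x, hx⟩, ?_⟩
    rw [hsingle]
  let E : (Π₀ i, A i) ≃+ M := AddEquiv.ofBijective F ⟨hinj, hsurj⟩
  have hE : ∀ i (x : M) (hx : x ∈ A i), E.symm x = DFinsupp.single i ⟨x, hx⟩ := by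
    intro i x hx
    rw [AddEquiv.symm_apply_eq]
    exact (hsingle i ⟨x, hx⟩).symm
  refine ⟨fun γ => ((A γ).subtype.comp (DFinsupp.evalAddMonoidHom γ)).comp
    E.symm.toAddMonoidHom, ?_, ?_, ?_⟩
  · intro γ m
    exact (E.symm m γ).2
  · intro γ m hm
    change ((E.symm m γ : A γ) : M) = m
    rw [hE γ m hm, DFinsupp.single_eq_same]
  · intro γ δ h m hm
    change ((E.symm m γ : A γ) : M) = 0
    rw [hE δ m hm, DFinsupp.single_eq_of_ne h]
    rfl

/-- A family of subgroups admitting projections is independent. -/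
theorem inf_iSup_ne_eq_bot_of_proj (p : ι → M →+ M) (hp : ∀ γ, ∀ m ∈ A γ, p γ m = m)
    (hp' : ∀ γ δ, γ ≠ δ → ∀ m ∈ A δ, p γ m = 0) (γ : ι) :
    A γ ⊓ (⨆ (δ) (_ : δ ≠ γ), A δ) = ⊥ := by
  rw [eq_bot_iff]
  rintro x ⟨hx, hx'⟩
  have hle : (⨆ (δ) (_ : δ ≠ γ), A δ) ≤ (p γ).ker :=
    iSup₂_le fun δ hδ m hm => hp' γ δ hδ.symm m hm
  have h0 : p γ x = 0 := hle hx'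
  rw [AddSubgroup.mem_bot, ← hp γ x hx, h0]

end GradedFamily

namespace Gpd

variable {Γ : Type u} (G : Gpd Γ)

theorem comp_congr {γ γ' δ δ' : Γ} (h₁ : γ = γ') (h₂ : δ = δ') (h : G.src γ = G.tgt δ) :
    G.comp γ δ h = G.comp γ' δ' (h₁ ▸ h₂ ▸ h) := by
  subst h₁ h₂
  rfl

theorem inv_comp_cancel {γ δ : Γ} (h : G.src γ = G.tgt δ)
    (h' : G.src (G.inv γ) = G.tgt (G.comp γ δ h)) :
    G.comp (G.inv γ) (G.comp γ δ h) h' = δ := by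
  rw [← G.comp_assoc (G.inv γ) γ δ (G.src_inv γ) h,
    G.comp_congr ((G.inv_comp γ).trans h) (rfl : δ = δ)]
  exact G.id_comp δ

theorem comp_inv_cancel {γ δ : Γ} (h : G.src γ = G.tgt (G.inv δ))
    (h' : G.src (G.comp γ (G.inv δ) h) = G.tgt δ) :
    G.comp (G.comp γ (G.inv δ) h) δ h' = γ := by
  have h₁ : G.src γ = G.src δ := h.trans (G.tgt_inv δ)
  rw [G.comp_assoc γ (G.inv δ) δ h (G.src_inv δ),
    G.comp_congr (rfl : γ = γ) ((G.inv_comp δ).trans h₁.symm)]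
  exact G.comp_id γ

theorem comp_inv_cancel' {γ δ : Γ} (h : G.src γ = G.tgt δ)
    (h' : G.src (G.comp γ δ h) = G.tgt (G.inv δ)) :
    G.comp (G.comp γ δ h) (G.inv δ) h' = γ := by
  rw [G.comp_assoc γ δ (G.inv δ) h (G.tgt_inv δ).symm,
    G.comp_congr (rfl : γ = γ) ((G.comp_inv δ).trans h.symm)]
  exact G.comp_id γ

theorem inv_comp_cancel' {γ δ : Γ} (h : G.src (G.inv γ) = G.tgt δ)
    (h' : G.src γ = G.tgt (G.comp (G.inv γ) δ h)) :
    G.comp γ (G.comp (G.inv γ) δ h) h' = δ := by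
  have h₁ : G.tgt γ = G.tgt δ := (G.src_inv γ).symm.trans h
  rw [← G.comp_assoc γ (G.inv γ) δ (G.tgt_inv γ).symm h,
    G.comp_congr ((G.comp_inv γ).trans h₁) (rfl : δ = δ)]
  exact G.id_comp δ

theorem comp_left_cancel {γ δ ε : Γ} (h : G.src γ = G.tgt δ) (h' : G.src γ = G.tgt ε)
    (he : G.comp γ δ h = G.comp γ ε h') : δ = ε := by
  have h₁ : G.src (G.inv γ) = G.tgt (G.comp γ δ h) := by rw [G.src_inv, G.tgt_comp]
  have h₂ : G.src (G.inv γ) = G.tgt (G.comp γ ε h') := by rw [G.src_inv, G.tgt_comp]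
  rw [← G.inv_comp_cancel h h₁, ← G.inv_comp_cancel h' h₂, G.comp_congr rfl he]

theorem IsObj.tgt_eq {G : Gpd Γ} {e : Γ} (he : G.IsObj e) : G.tgt e = e := by
  have h := G.tgt_src e
  rwa [show G.src e = e from he] at h

theorem isObj_tgt (γ : Γ) : G.IsObj (G.tgt γ) := G.src_tgt γ

theorem isObj_src (γ : Γ) : G.IsObj (G.src γ) := G.src_src γ

theorem comp_eq_left {γ e : Γ} (he : G.IsObj e) (h : G.src γ = G.tgt e) :
    G.comp γ e h = γ := by
  have h₁ : e = G.src γ := by rw [h, he.tgt_eq]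
  rw [G.comp_congr (rfl : γ = γ) h₁]
  exact G.comp_id γ

theorem comp_eq_right {γ e : Γ} (he : G.IsObj e) (h : G.src e = G.tgt γ) :
    G.comp e γ h = γ := by
  have h₁ : e = G.tgt γ := by rw [← h]; exact he.symm
  rw [G.comp_congr h₁ (rfl : γ = γ)]
  exact G.id_comp γ

theorem IsObj.inv_eq {G : Gpd Γ} {e : Γ} (he : G.IsObj e) : G.inv e = e := by
  rw [← G.comp_eq_right he (G.tgt_inv e).symm, G.comp_inv, he.tgt_eq]

theorem conj?_eq_some {σ γ τ : Γ} (h₁ : G.src σ = G.tgt γ)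
    (h₂ : G.src (G.comp σ γ h₁) = G.tgt (G.inv τ)) :
    G.conj? σ γ τ = some (G.comp (G.comp σ γ h₁) (G.inv τ) h₂) := by
  simp [conj?, mul?, h₁, h₂]

theorem conj?_eq_none_left {σ γ τ : Γ} (h : G.src σ ≠ G.tgt γ) : G.conj? σ γ τ = none := by
  simp [conj?, mul?, h]

theorem conj?_eq_none_right {σ γ τ : Γ} (h : G.src γ ≠ G.src τ) : G.conj? σ γ τ = none := by
  by_cases h₁ : G.src σ = G.tgt γ
  · simp [conj?, mul?, h₁, G.src_comp, G.tgt_inv, h]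
  · exact G.conj?_eq_none_left h₁

end Gpd

namespace GammaMod

variable {Γ : Type u} {G : Gpd Γ} {R : Type v} [NonUnitalRing R] {RG : GammaRing G R}
  {M : Type w} [AddCommGroup M] (Mod : GammaMod RG M)

/-- The projection onto the homogeneous component of degree `γ`. -/
noncomputable def proj (γ : Γ) : M →+ M :=
  Classical.choose (exists_gradedProj Mod.grade_iSup Mod.grade_indep) γ

theorem proj_mem (γ : Γ) (m : M) : Mod.proj γ m ∈ Mod.grade γ :=
  (Classical.choose_spec (exists_gradedProj Mod.grade_iSup Mod.grade_indep)).1 γ m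

theorem proj_of_mem {γ : Γ} {m : M} (hm : m ∈ Mod.grade γ) : Mod.proj γ m = m :=
  (Classical.choose_spec (exists_gradedProj Mod.grade_iSup Mod.grade_indep)).2.1 γ m hm

theorem proj_of_ne {γ δ : Γ} (h : γ ≠ δ) {m : M} (hm : m ∈ Mod.grade δ) :
    Mod.proj γ m = 0 :=
  (Classical.choose_spec (exists_gradedProj Mod.grade_iSup Mod.grade_indep)).2.2 γ δ h m hm

theorem hom_induction {C : M → Prop} (m : M) (hom : ∀ γ, ∀ m ∈ Mod.grade γ, C m)
    (h_zero : C 0) (h_add : ∀ x y, C x → C y → C (x + y)) : C m :=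
  AddSubgroup.iSup_induction Mod.grade (C := C)
    (by rw [Mod.grade_iSup]; exact AddSubgroup.mem_top m) hom h_zero h_add

theorem mem_of_proj_mem {N : AddSubgroup M} {m : M} (h : ∀ γ, Mod.proj γ m ∈ N) :
    m ∈ ⨆ γ, (Mod.grade γ ⊓ N) := by
  classical
  have key : ∃ s : Finset Γ, (∀ γ ∉ s, Mod.proj γ m = 0) ∧ m = ∑ γ ∈ s, Mod.proj γ m := by
    refine Mod.hom_induction (C := fun m => ∃ s : Finset Γ, (∀ γ ∉ s, Mod.proj γ m = 0) ∧
      m = ∑ γ ∈ s, Mod.proj γ m) m (fun δ m hm => ⟨{δ}, ?_, ?_⟩) ⟨∅, by simp⟩ ?_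
    · intro γ hγ
      exact Mod.proj_of_ne (by simpa using hγ) hm
    · simp [Mod.proj_of_mem hm]
    · rintro x y ⟨s, hs, hx⟩ ⟨t, ht, hy⟩
      refine ⟨s ∪ t, fun γ hγ => ?_, ?_⟩
      · rw [Finset.mem_union, not_or] at hγ
        rw [map_add, hs γ hγ.1, ht γ hγ.2, add_zero]
      · simp only [map_add, Finset.sum_add_distrib]
        rw [← Finset.sum_subset Finset.subset_union_left (fun γ _ h => hs γ h), ← hx,
          ← Finset.sum_subset Finset.subset_union_right (fun γ _ h => ht γ h), ← hy]
  obtain ⟨s, -, hm⟩ := key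
  rw [hm]
  exact AddSubgroup.sum_mem _ fun γ _ =>
    AddSubgroup.mem_iSup_of_mem γ ⟨Mod.proj_mem γ m, h γ⟩

theorem eq_zero_of_proj {m : M} (h : ∀ γ, Mod.proj γ m = 0) : m = 0 := by
  have := Mod.mem_of_proj_mem (N := ⊥) (m := m) (fun γ => by simp [h γ])
  simpa using this

theorem proj_mem_of_mem {N : AddSubgroup M} (hN : N ≤ ⨆ γ, (Mod.grade γ ⊓ N)) {m : M}
    (hm : m ∈ N) (γ : Γ) : Mod.proj γ m ∈ N := by
  classical
  refine AddSubgroup.iSup_induction _ (C := fun m => Mod.proj γ m ∈ N) (hN hm) ?_ ?_ ?_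
  · rintro δ x ⟨hx, hxN⟩
    by_cases h : γ = δ
    · subst h
      rwa [Mod.proj_of_mem hx]
    · rw [Mod.proj_of_ne h hx]
      exact N.zero_mem
  · simp
  · intro x y hx hy
    rw [map_add]
    exact N.add_mem hx hy

theorem isGradedSub_iff {N : AddSubgroup M} :
    Mod.IsGradedSub N ↔ (∀ m ∈ N, ∀ a : R, Mod.smul m a ∈ N) ∧
      ∀ m ∈ N, ∀ γ, Mod.proj γ m ∈ N :=
  and_congr_right fun _ => ⟨fun h _ hm γ => Mod.proj_mem_of_mem h hm γ,
    fun h _ hm => Mod.mem_of_proj_mem (h _ hm)⟩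

/-- Right multiplication by `a`, as an additive map. -/
def smulHom (a : R) : M →+ M := AddMonoidHom.mk' (fun m => Mod.smul m a)
  fun m n => Mod.add_smul m n a

/-- The additive map `a ↦ m a`. -/
def orbitHom (m : M) : R →+ M := AddMonoidHom.mk' (fun a => Mod.smul m a)
  fun a b => Mod.smul_add m a b

theorem zero_smul (a : R) : Mod.smul 0 a = 0 := (Mod.smulHom a).map_zero

theorem smul_zero (m : M) : Mod.smul m 0 = 0 := (Mod.orbitHom m).map_zero

theorem smul_sub (m : M) (a b : R) : Mod.smul m (a - b) = Mod.smul m a - Mod.smul m b :=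
  (Mod.orbitHom m).map_sub a b

theorem exists_smul_mem {γ δ : Γ} {m : M} {a : R} (hm : m ∈ Mod.grade γ)
    (ha : a ∈ RG.grade δ) : ∃ ε, Mod.smul m a ∈ Mod.grade ε := by
  by_cases h : G.src γ = G.tgt δ
  · exact ⟨_, Mod.smul_mem γ δ h m a hm ha⟩
  · exact ⟨γ, by rw [Mod.smul_ne γ δ h m a hm ha]; exact AddSubgroup.zero_mem _⟩

theorem proj_smul {γ δ : Γ} (h : G.src γ = G.tgt δ) {m : M} (hm : m ∈ Mod.grade γ) (a : R) :
    Mod.proj (G.comp γ δ h) (Mod.smul m a) = Mod.smul m (RG.regular.proj δ a) := by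
  refine RG.regular.hom_induction (C := fun a =>
    Mod.proj (G.comp γ δ h) (Mod.smul m a) = Mod.smul m (RG.regular.proj δ a)) a
    (fun ε a ha => ?_) ?_ ?_
  · by_cases hε : δ = ε
    · subst hε
      rw [RG.regular.proj_of_mem ha, Mod.proj_of_mem (Mod.smul_mem γ δ h m a hm ha)]
    · rw [RG.regular.proj_of_ne hε ha, Mod.smul_zero]
      by_cases h' : G.src γ = G.tgt ε
      · refine Mod.proj_of_ne (fun he => hε (G.comp_left_cancel h h' he))
          (Mod.smul_mem γ ε h' m a hm ha)
      · rw [Mod.smul_ne γ ε h' m a hm ha, map_zero]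
  · simp [Mod.smul_zero]
  · intro x y hx hy
    rw [Mod.smul_add, map_add, map_add, Mod.smul_add, hx, hy]

theorem smul_proj_of_ne {γ δ : Γ} (h : G.src γ ≠ G.tgt δ) {m : M} (hm : m ∈ Mod.grade γ)
    (a : R) : Mod.smul m (RG.regular.proj δ a) = 0 :=
  Mod.smul_ne γ δ h m _ hm (RG.regular.proj_mem δ a)

theorem IsGradedSub.inf {N P : AddSubgroup M} (hN : Mod.IsGradedSub N)
    (hP : Mod.IsGradedSub P) : Mod.IsGradedSub (N ⊓ P) := by
  rw [isGradedSub_iff] at *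
  exact ⟨fun m hm a => ⟨hN.1 m hm.1 a, hP.1 m hm.2 a⟩,
    fun m hm γ => ⟨hN.2 m hm.1 γ, hP.2 m hm.2 γ⟩⟩

theorem isGradedSub_iSup {κ : Sort*} {f : κ → AddSubgroup M}
    (hf : ∀ i, Mod.IsGradedSub (f i)) : Mod.IsGradedSub (⨆ i, f i) := by
  constructor
  · intro m hm a
    refine AddSubgroup.iSup_induction f (C := fun m => Mod.smul m a ∈ ⨆ i, f i) hm ?_ ?_ ?_
    · intro i x hx
      exact AddSubgroup.mem_iSup_of_mem i ((hf i).1 x hx a)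
    · rw [Mod.zero_smul]
      exact AddSubgroup.zero_mem _
    · intro x y hx hy
      rw [Mod.add_smul]
      exact AddSubgroup.add_mem _ hx hy
  · exact iSup_le fun i => (hf i).2.trans
      (iSup_mono fun γ => inf_le_inf_left _ (le_iSup f i))

theorem IsGradedSub.sup {N P : AddSubgroup M} (hN : Mod.IsGradedSub N)
    (hP : Mod.IsGradedSub P) : Mod.IsGradedSub (N ⊔ P) := by
  rw [sup_eq_iSup]
  exact Mod.isGradedSub_iSup fun b => by cases b <;> simpa

/-- The image of a graded right ideal under the map `a ↦ m a`, for `m` homogeneous,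
is a graded submodule. -/
theorem isGradedSub_map_orbitHom {γ : Γ} {m : M} (hm : m ∈ Mod.grade γ) {P : AddSubgroup R}
    (hP : RG.regular.IsGradedSub P) : Mod.IsGradedSub (P.map (Mod.orbitHom m)) := by
  constructor
  · rintro _ ⟨p, hp, rfl⟩ a
    exact ⟨p * a, hP.1 p hp a, Mod.smul_mul m p a⟩
  · rintro _ ⟨p, hp, rfl⟩
    refine AddSubgroup.iSup_induction _ (C := fun p => Mod.orbitHom m p ∈ _)
      (hP.2 hp) ?_ ?_ ?_
    · rintro δ x ⟨hx, hxP⟩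
      obtain ⟨ε, hε⟩ := Mod.exists_smul_mem hm hx
      exact AddSubgroup.mem_iSup_of_mem ε ⟨hε, x, hxP, rfl⟩
    · rw [map_zero]
      exact AddSubgroup.zero_mem _
    · intro x y hx hy
      rw [map_add]
      exact AddSubgroup.add_mem _ hx hy

/-- The set of `a` with `m a ∈ P`, for `m` homogeneous and `P` graded, is a graded
right ideal. -/
theorem isGradedSub_comap_orbitHom {γ : Γ} {m : M} (hm : m ∈ Mod.grade γ)
    {P : AddSubgroup M} (hP : Mod.IsGradedSub P) :
    RG.regular.IsGradedSub (P.comap (Mod.orbitHom m)) := by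
  rw [isGradedSub_iff] at *
  constructor
  · intro a ha b
    change Mod.smul m (a * b) ∈ P
    rw [Mod.smul_mul]
    exact hP.1 _ ha b
  · intro a ha δ
    change Mod.smul m _ ∈ P
    by_cases h : G.src γ = G.tgt δ
    · rw [← Mod.proj_smul h hm]
      exact hP.2 _ ha _
    · rw [Mod.smul_proj_of_ne h hm]
      exact P.zero_mem

theorem exists_hom_ne_zero {N : AddSubgroup M} (hN : N ≤ ⨆ γ, (Mod.grade γ ⊓ N))
    (h : N ≠ ⊥) : ∃ γ, ∃ m ∈ Mod.grade γ, m ∈ N ∧ m ≠ 0 := by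
  by_contra! hc
  refine h (eq_bot_iff.mpr fun m hm => ?_)
  rw [AddSubgroup.mem_bot]
  exact Mod.eq_zero_of_proj fun γ => hc γ _ (Mod.proj_mem γ m) (Mod.proj_mem_of_mem hN hm γ)

end GammaMod

namespace GammaRing

variable {Γ : Type u} {G : Gpd Γ} {R : Type v} [NonUnitalRing R] (RG : GammaRing G R)

theorem mul_zero_or_mem {γ δ : Γ} {a b : R} (ha : a ∈ RG.grade γ) (hb : b ∈ RG.grade δ) :
    ∃ ε, a * b ∈ RG.grade ε :=
  RG.regular.exists_smul_mem ha hb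

theorem one_mul_of_tgt {e γ : Γ} {a : R} (h : G.tgt γ = e) (ha : a ∈ RG.grade γ) :
    RG.one e * a = a := by
  subst h
  exact RG.one_mul' γ a ha

theorem mul_one_of_src {e γ : Γ} {a : R} (h : G.src γ = e) (ha : a ∈ RG.grade γ) :
    a * RG.one e = a := by
  subst h
  exact RG.mul_one' γ a ha

theorem one_mul_one {e : Γ} (he : G.IsObj e) : RG.one e * RG.one e = RG.one e :=
  RG.one_mul_of_tgt he.tgt_eq (RG.one_mem e he)

theorem one_mul_of_ne {e γ : Γ} (he : G.IsObj e) {a : R} (h : G.tgt γ ≠ e)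
    (ha : a ∈ RG.grade γ) : RG.one e * a = 0 :=
  RG.mul_ne e γ (fun h' => h (h'.symm.trans he)) _ _ (RG.one_mem e he) ha

theorem mul_one_of_ne {e γ : Γ} (he : G.IsObj e) {a : R} (h : G.src γ ≠ e)
    (ha : a ∈ RG.grade γ) : a * RG.one e = 0 :=
  RG.mul_ne γ e (fun h' => h (h'.trans he.tgt_eq)) _ _ ha (RG.one_mem e he)

theorem mem_eComp_iff {e : Γ} (he : G.IsObj e) {a : R} :
    a ∈ RG.regular.eComp e ↔ RG.one e * a = a := by
  constructor
  · intro ha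
    have hle : RG.regular.eComp e ≤
        (AddMonoidHom.mulLeft (RG.one e) - AddMonoidHom.id R).ker :=
      iSup₂_le fun γ hγ b hb => by
        change RG.one e * b - b = 0
        rw [RG.one_mul_of_tgt hγ hb, sub_self]
    exact sub_eq_zero.mp (hle ha)
  · intro ha
    rw [← ha]
    refine RG.regular.hom_induction (C := fun a => RG.one e * a ∈ RG.regular.eComp e) a ?_ ?_ ?_
    · intro γ b hb
      by_cases h : G.tgt γ = e
      · rw [RG.one_mul_of_tgt h hb]
        exact AddSubgroup.mem_iSup_of_mem γ (AddSubgroup.mem_iSup_of_mem h hb)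
      · rw [RG.one_mul_of_ne he h hb]
        exact AddSubgroup.zero_mem _
    · rw [mul_zero]
      exact AddSubgroup.zero_mem _
    · intro x y hx hy
      rw [mul_add]
      exact AddSubgroup.add_mem _ hx hy

theorem isGradedSub_eComp {e : Γ} (he : G.IsObj e) :
    RG.regular.IsGradedSub (RG.regular.eComp e) := by
  constructor
  · intro m hm a
    rw [RG.mem_eComp_iff he] at hm ⊢
    change RG.one e * (m * a) = m * a
    rw [← mul_assoc, hm]
  · exact iSup₂_le fun γ hγ b hb => AddSubgroup.mem_iSup_of_mem γ
      ⟨hb, AddSubgroup.mem_iSup_of_mem γ (AddSubgroup.mem_iSup_of_mem hγ hb)⟩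

theorem one_mem_eComp {e : Γ} (he : G.IsObj e) : RG.one e ∈ RG.regular.eComp e :=
  (RG.mem_eComp_iff he).mpr (RG.one_mul_one he)

theorem IsGradedIdeal.isGradedSub {RG : GammaRing G R} {I : AddSubgroup R}
    (hI : RG.IsGradedIdeal I) : RG.regular.IsGradedSub I :=
  ⟨fun m hm a => (hI.1 m hm a).1, hI.2⟩

/-- A graded right ideal containing `1_e` contains `R(e)`. -/
theorem eComp_le {e : Γ} (he : G.IsObj e) {P : AddSubgroup R}
    (hP : RG.regular.IsGradedSub P) (h : RG.one e ∈ P) : RG.regular.eComp e ≤ P := by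
  intro a ha
  rw [← (RG.mem_eComp_iff he).mp ha]
  exact hP.1 _ h a

theorem exists_one_ne_zero (h : ∃ a : R, a ≠ 0) : ∃ e, G.IsObj e ∧ RG.one e ≠ 0 := by
  by_contra! hc
  obtain ⟨a, ha⟩ := h
  refine ha (RG.regular.eq_zero_of_proj fun γ => ?_)
  have := RG.one_mul' γ _ (RG.regular.proj_mem γ a)
  rw [← this, hc _ (G.isObj_tgt γ), zero_mul]

/-- The ideal `R 1_e R`. -/
def oneIdeal (e : Γ) : AddSubgroup R :=
  AddSubgroup.closure {r | ∃ a b : R, r = a * RG.one e * b}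

theorem mem_oneIdeal {e : Γ} (a b : R) : a * RG.one e * b ∈ RG.oneIdeal e :=
  AddSubgroup.subset_closure ⟨a, b, rfl⟩

theorem oneIdeal_le {e : Γ} {N : AddSubgroup R} (h : ∀ a b : R, a * RG.one e * b ∈ N) :
    RG.oneIdeal e ≤ N := by
  rw [oneIdeal, AddSubgroup.closure_le]
  rintro _ ⟨a, b, rfl⟩
  exact h a b

theorem one_mem_oneIdeal {e : Γ} (he : G.IsObj e) : RG.one e ∈ RG.oneIdeal e := by
  have := RG.mem_oneIdeal (e := e) (RG.one e) (RG.one e)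
  rwa [RG.one_mul_one he, RG.one_mul_one he] at this

theorem isGradedIdeal_oneIdeal {e : Γ} (he : G.IsObj e) : RG.IsGradedIdeal (RG.oneIdeal e) := by
  constructor
  · intro a ha r
    constructor
    · exact (RG.oneIdeal_le (N := (RG.oneIdeal e).comap (AddMonoidHom.mulRight r))
        fun a b => by
          change a * RG.one e * b * r ∈ RG.oneIdeal e
          rw [mul_assoc _ b r]
          exact RG.mem_oneIdeal _ _) ha
    · exact (RG.oneIdeal_le (N := (RG.oneIdeal e).comap (AddMonoidHom.mulLeft r))
        fun a b => by
          change r * (a * RG.one e * b) ∈ RG.oneIdeal e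
          rw [← mul_assoc, ← mul_assoc]
          exact RG.mem_oneIdeal _ _) ha
  · refine RG.oneIdeal_le fun a b => ?_
    refine RG.regular.hom_induction
      (C := fun a => a * RG.one e * b ∈ ⨆ γ, (RG.grade γ ⊓ RG.oneIdeal e)) a ?_ ?_ ?_
    · intro γ a ha
      refine RG.regular.hom_induction
        (C := fun b => a * RG.one e * b ∈ ⨆ γ, (RG.grade γ ⊓ RG.oneIdeal e)) b ?_ ?_ ?_
      · intro δ b hb
        obtain ⟨ε, hε⟩ := RG.mul_zero_or_mem ha (RG.one_mem e he)
        obtain ⟨η, hη⟩ := RG.mul_zero_or_mem hε hb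
        exact AddSubgroup.mem_iSup_of_mem η ⟨hη, RG.mem_oneIdeal a b⟩
      · rw [mul_zero]
        exact AddSubgroup.zero_mem _
      · intro x y hx hy
        rw [mul_add]
        exact AddSubgroup.add_mem _ hx hy
    · rw [zero_mul, zero_mul]
      exact AddSubgroup.zero_mem _
    · intro x y hx hy
      rw [add_mul, add_mul]
      exact AddSubgroup.add_mem _ hx hy

theorem oneIdeal_eq_top {e : Γ} (he : G.IsObj e) (h1 : RG.one e ≠ 0)
    (hR : RG.IsGrSimpleRing) : RG.oneIdeal e = ⊤ := by
  refine (hR.2 _ (RG.isGradedIdeal_oneIdeal he)).resolve_left fun h => h1 ?_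
  have := RG.one_mem_oneIdeal he
  rwa [h, AddSubgroup.mem_bot] at this

theorem one_ne_zero_of_isGrSimpleSub {e : Γ} (he : G.IsObj e)
    (hS : RG.regular.IsGrSimpleSub (RG.regular.eComp e)) : RG.one e ≠ 0 := by
  intro h
  refine hS.2.1 (eq_bot_iff.mpr fun a ha => ?_)
  rw [RG.mem_eComp_iff he, h, zero_mul] at ha
  exact ha.symm

theorem IsGrSimpleRing.isGrPrime {RG : GammaRing G R} (h : RG.IsGrSimpleRing) :
    RG.IsGrPrime := by
  refine ⟨h.1, fun I J hI hJ hI0 hJ0 => ?_⟩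
  obtain ⟨e, he, h1⟩ := RG.exists_one_ne_zero h.1
  rw [(h.2 I hI).resolve_left hI0, (h.2 J hJ).resolve_left hJ0]
  exact ⟨RG.one e, trivial, RG.one e, trivial, by rwa [RG.one_mul_one he]⟩

end GammaRing

namespace GammaMod

variable {Γ : Type u} {G : Gpd Γ} {R : Type v} [NonUnitalRing R] {RG : GammaRing G R}
  {M : Type w} [AddCommGroup M] (Mod : GammaMod RG M)

theorem smul_one_of_src {e γ : Γ} {x : M} (h : G.src γ = e) (hx : x ∈ Mod.grade γ) :
    Mod.smul x (RG.one e) = x := by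
  subst h
  exact Mod.smul_one γ x hx

theorem mem_or_eq_zero_of_smul_mem {e : Γ} (he : G.IsObj e)
    (hS : RG.regular.IsGrSimpleSub (RG.regular.eComp e)) {γ : Γ} {x : M}
    (hx : x ∈ Mod.grade γ) (hγ : G.src γ = e) {P : AddSubgroup M} (hP : Mod.IsGradedSub P) :
    x ∈ P ∨ ∀ a, RG.one e * a = a → Mod.smul x a ∈ P → a = 0 := by
  have hQ := (RG.isGradedSub_eComp he).inf _ (Mod.isGradedSub_comap_orbitHom hx hP)
  rcases hS.2.2 _ hQ inf_le_left with h | h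
  · right
    intro a ha haP
    have : a ∈ RG.regular.eComp e ⊓ P.comap (Mod.orbitHom x) :=
      ⟨(RG.mem_eComp_iff he).mpr ha, haP⟩
    rwa [h] at this
  · left
    have : RG.one e ∈ RG.regular.eComp e ⊓ P.comap (Mod.orbitHom x) := by
      rw [h]
      exact RG.one_mem_eComp he
    have h' : Mod.smul x (RG.one e) ∈ P := this.2
    rwa [Mod.smul_one_of_src hγ hx] at h'

/-- The graded submodule generated by a set `B`. -/
def span (B : Set M) : AddSubgroup M := ⨆ x : B, (⊤ : AddSubgroup R).map (Mod.orbitHom x)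

theorem smul_mem_span {B : Set M} {x : M} (hx : x ∈ B) (a : R) : Mod.smul x a ∈ Mod.span B :=
  AddSubgroup.mem_iSup_of_mem (⟨x, hx⟩ : B) ⟨a, trivial, rfl⟩

/-- The nonzero homogeneous elements whose degree has source `e`. -/
def sourceSet (e : Γ) : Set M := {x | x ≠ 0 ∧ ∃ γ, G.src γ = e ∧ x ∈ Mod.grade γ}

theorem isGradedSub_span {e : Γ} {B : Set M} (hB : B ⊆ Mod.sourceSet e) :
    Mod.IsGradedSub (Mod.span B) := by
  refine Mod.isGradedSub_iSup fun x => ?_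
  obtain ⟨-, γ, -, hx⟩ := hB x.2
  exact Mod.isGradedSub_map_orbitHom hx RG.regular.isGradedSub_top

/-- The elements of `B` are independent over `1_e R`. -/
def IndepSet (e : Γ) (B : Set M) : Prop :=
  ∀ c : M →₀ R, (c.support : Set M) ⊆ B → (∀ x, RG.one e * c x = c x) →
    (c.sum fun x a => Mod.smul x a) = 0 → c = 0

theorem exists_sum_of_mem_span {e : Γ} {B : Set M} (he : G.IsObj e)
    (hB : B ⊆ Mod.sourceSet e) {m : M} (hm : m ∈ Mod.span B) :
    ∃ c : M →₀ R, (c.support : Set M) ⊆ B ∧ (∀ x, RG.one e * c x = c x) ∧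
      m = c.sum fun x a => Mod.smul x a := by
  classical
  refine AddSubgroup.iSup_induction _ (C := fun m => ∃ c : M →₀ R,
    (c.support : Set M) ⊆ B ∧ (∀ x, RG.one e * c x = c x) ∧
      m = c.sum fun x a => Mod.smul x a) hm ?_ ?_ ?_
  · rintro ⟨x, hx⟩ _ ⟨a, -, rfl⟩
    obtain ⟨-, γ, hγ, hxγ⟩ := hB hx
    refine ⟨Finsupp.single x (RG.one e * a), ?_, ?_, ?_⟩
    · refine (Finset.coe_subset.mpr Finsupp.support_single_subset).trans ?_
      simpa using hx
    · intro y
      by_cases h : x = y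
      · subst h
        rw [Finsupp.single_eq_same, ← mul_assoc, RG.one_mul_one he]
      · rw [Finsupp.single_eq_of_ne (Ne.symm h), mul_zero]
    · rw [Finsupp.sum_single_index (Mod.smul_zero x), Mod.smul_mul,
        Mod.smul_one_of_src hγ hxγ]
      rfl
  · exact ⟨0, by simp, by simp, by simp⟩
  · rintro _ _ ⟨c, hc, hc', rfl⟩ ⟨d, hd, hd', rfl⟩
    refine ⟨c + d, ?_, ?_, ?_⟩
    · intro z hz
      rcases Finset.mem_union.mp (Finsupp.support_add hz) with h | h
      · exact hc h
      · exact hd h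
    · intro z
      rw [Finsupp.add_apply, mul_add, hc', hd']
    · rw [Finsupp.sum_add_index' (fun x => Mod.smul_zero x) (fun x => Mod.smul_add x)]

theorem sum_mem_span {B : Set M} {c : M →₀ R} (hc : (c.support : Set M) ⊆ B) :
    (c.sum fun x a => Mod.smul x a) ∈ Mod.span B :=
  AddSubgroup.sum_mem _ fun _ hx => Mod.smul_mem_span (hc hx) _

theorem exists_indepSet_span_eq_top {e : Γ} (he : G.IsObj e) (hR : RG.IsGrSimpleRing)
    (hS : RG.regular.IsGrSimpleSub (RG.regular.eComp e)) :
    ∃ B ⊆ Mod.sourceSet e, Mod.IndepSet e B ∧ Mod.span B = ⊤ := by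
  classical
  obtain ⟨B, hBmax⟩ := zorn_subset {B | B ⊆ Mod.sourceSet e ∧ Mod.IndepSet e B} (by
    intro c hc hchain
    rcases c.eq_empty_or_nonempty with rfl | hne
    · refine ⟨∅, ⟨Set.empty_subset _, fun d hd _ _ => ?_⟩, by simp⟩
      simpa using hd
    · refine ⟨⋃₀ c, ⟨Set.sUnion_subset fun s hs => (hc hs).1, fun d hd hd' h0 => ?_⟩,
        fun s hs => Set.subset_sUnion_of_mem hs⟩
      rw [Set.sUnion_eq_biUnion] at hd
      obtain ⟨s, hs, hds⟩ := DirectedOn.exists_mem_subset_of_finset_subset_biUnion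
        (f := fun s : Set M => s) hne hchain.directedOn hd
      exact (hc hs).2 d hds hd' h0)
  obtain ⟨⟨hBX, hBI⟩, hmax⟩ := hBmax
  have hspan := Mod.isGradedSub_span hBX
  have hXB : ∀ x ∈ Mod.sourceSet e, x ∈ Mod.span B := by
    rintro x ⟨hx0, γ, hγ, hx⟩
    rcases Mod.mem_or_eq_zero_of_smul_mem he hS hx hγ hspan with h | h
    · exact h
    have hins : insert x B ⊆ B := hmax ⟨Set.insert_subset ⟨hx0, γ, hγ, hx⟩ hBX, by
      intro c hc hc' h0
      rw [← Finsupp.single_add_erase x c, Finsupp.sum_add_index' (fun x => Mod.smul_zero x)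
        (fun x => Mod.smul_add x), Finsupp.sum_single_index (Mod.smul_zero x)] at h0
      have herase : ((c.erase x).support : Set M) ⊆ B := by
        intro y hy
        rw [Finsupp.support_erase, Finset.mem_coe, Finset.mem_erase] at hy
        exact (hc hy.2).resolve_left hy.1
      have hcx : c x = 0 := by
        refine h _ (hc' x) ?_
        rw [eq_neg_of_add_eq_zero_left h0]
        exact AddSubgroup.neg_mem _ (Mod.sum_mem_span herase)
      rw [hcx, Mod.smul_zero, zero_add] at h0
      have := hBI _ herase (fun y => by
        by_cases hy : y = x
        · rw [hy, Finsupp.erase_same, mul_zero]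
        · rw [Finsupp.erase_ne hy, hc']) h0
      rw [← Finsupp.single_add_erase x c, hcx, this]
      simp⟩ (Set.subset_insert _ _)
    have := Mod.smul_mem_span (hins (Set.mem_insert x B)) (RG.one e)
    rwa [Mod.smul_one_of_src hγ hx] at this
  refine ⟨B, hBX, hBI, eq_top_iff.mpr fun m _ => ?_⟩
  refine Mod.hom_induction (C := fun m => m ∈ Mod.span B) m ?_ (AddSubgroup.zero_mem _)
    fun x y => AddSubgroup.add_mem _
  intro γ m hm
  have hle : RG.oneIdeal e ≤ (Mod.span B).comap (Mod.orbitHom m) := by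
    refine RG.oneIdeal_le fun a b => ?_
    change Mod.smul m (a * RG.one e * b) ∈ Mod.span B
    rw [Mod.smul_mul]
    refine hspan.1 _ ?_ b
    refine RG.regular.hom_induction (C := fun a => Mod.smul m (a * RG.one e) ∈ Mod.span B) a
      ?_ ?_ ?_
    · intro δ a ha
      by_cases hδ : G.src δ = e
      · rw [RG.mul_one_of_src hδ ha]
        by_cases h0 : Mod.smul m a = 0
        · rw [h0]
          exact AddSubgroup.zero_mem _
        · by_cases hγδ : G.src γ = G.tgt δ
          · exact hXB _ ⟨h0, _, (G.src_comp γ δ hγδ).trans hδ, Mod.smul_mem γ δ hγδ m a hm ha⟩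
          · exact absurd (Mod.smul_ne γ δ hγδ m a hm ha) h0
      · rw [RG.mul_one_of_ne he hδ ha, Mod.smul_zero]
        exact AddSubgroup.zero_mem _
    · rw [zero_mul, Mod.smul_zero]
      exact AddSubgroup.zero_mem _
    · intro x y hx hy
      rw [add_mul, Mod.smul_add]
      exact AddSubgroup.add_mem _ hx hy
  have : RG.one (G.src γ) ∈ RG.oneIdeal e := by
    rw [RG.oneIdeal_eq_top he (RG.one_ne_zero_of_isGrSimpleSub he hS) hR]
    trivial
  have h' : Mod.smul m (RG.one (G.src γ)) ∈ Mod.span B := hle this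
  rwa [Mod.smul_one γ m hm] at h'

theorem IndepSet.eq_zero_of_sum {Mod : GammaMod RG M} {e : Γ} {B : Set M}
    (h : Mod.IndepSet e B) {κ : Type*} (ι : κ ↪ M) (hι : ∀ i, ι i ∈ B) {c : κ →₀ R}
    (hc : ∀ i, RG.one e * c i = c i) (h0 : (c.sum fun i a => Mod.smul (ι i) a) = 0) :
    c = 0 := by
  have := h (c.embDomain ι) ?_ ?_ ?_
  · rwa [Finsupp.embDomain_eq_zero] at this
  · intro x hx
    rw [Finset.mem_coe, Finsupp.support_embDomain, Finset.mem_map] at hx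
    obtain ⟨i, -, rfl⟩ := hx
    exact hι i
  · intro x
    by_cases hx : x ∈ Set.range ι
    · obtain ⟨i, rfl⟩ := hx
      rw [Finsupp.embDomain_apply_self, hc]
    · rw [Finsupp.embDomain_of_notMem_range _ _ _ hx, mul_zero]
  · rwa [Finsupp.sum_embDomain]

theorem pseudoFree_of_isGrSimpleSub {e : Γ} (he : G.IsObj e) (hR : RG.IsGrSimpleRing)
    (hS : RG.regular.IsGrSimpleSub (RG.regular.eComp e)) : Mod.PseudoFree := by
  obtain ⟨B, hBX, hBI, hB⟩ := Mod.exists_indepSet_span_eq_top he hR hS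
  choose β hβe hβ using fun x (hx : x ∈ B) => (hBX hx).2
  let ι : ULift.{u} B ↪ M := ⟨fun i => i.down, fun i j h =>
    ULift.down_injective (Subtype.ext h)⟩
  refine ⟨ULift.{u} B, fun i => β (ι i) i.down.2, ι,
    ⟨fun i => ⟨hβ _ i.down.2, (hBX i.down.2).1⟩, fun a ha h0 => ?_⟩, ?_⟩
  · refine hBI.eq_zero_of_sum ι (fun i => i.down.2) (fun i => ?_) h0
    have := ha i
    rwa [show G.src (β (ι i) i.down.2) = e from hβe _ i.down.2] at this
  · rw [eq_top_iff, ← hB]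
    refine iSup_le ?_
    rintro x _ ⟨a, -, rfl⟩
    exact AddSubgroup.subset_closure ⟨⟨x⟩, a, rfl⟩

end GammaMod

namespace GammaMod

variable {Γ : Type u} {G : Gpd Γ} {R : Type v} [NonUnitalRing R] {RG : GammaRing G R}
  {M : Type w} [AddCommGroup M] (Mod : GammaMod RG M)

/-- The quotient of a graded module by a graded submodule. -/
def quot (N : AddSubgroup M) (hN : Mod.IsGradedSub N) : GammaMod RG (M ⧸ N) where
  smul q a := QuotientAddGroup.map N N (Mod.smulHom a) (fun m hm => hN.1 m hm a) q
  smul_add := by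
    rintro ⟨m⟩ a b
    exact congrArg (QuotientAddGroup.mk (s := N)) (Mod.smul_add m a b)
  add_smul m n a := map_add _ m n
  smul_mul := by
    rintro ⟨m⟩ a b
    exact congrArg (QuotientAddGroup.mk (s := N)) (Mod.smul_mul m a b)
  grade γ := (Mod.grade γ).map (QuotientAddGroup.mk' N)
  grade_iSup := by
    rw [← AddSubgroup.map_iSup, Mod.grade_iSup, ← AddMonoidHom.range_eq_map,
      AddMonoidHom.range_eq_top]
    exact QuotientAddGroup.mk'_surjective N
  grade_indep := inf_iSup_ne_eq_bot_of_proj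
    (fun γ => QuotientAddGroup.map N N (Mod.proj γ)
      fun m hm => (Mod.isGradedSub_iff.mp hN).2 m hm γ)
    (by
      rintro γ _ ⟨m, hm, rfl⟩
      exact congrArg (QuotientAddGroup.mk (s := N)) (Mod.proj_of_mem hm))
    (by
      rintro γ δ h _ ⟨m, hm, rfl⟩
      exact congrArg (QuotientAddGroup.mk (s := N)) (Mod.proj_of_ne h hm))
  smul_mem := by
    rintro σ τ h _ a ⟨m, hm, rfl⟩ ha
    exact ⟨_, Mod.smul_mem σ τ h m a hm ha, rfl⟩
  smul_ne := by
    rintro σ τ h _ a ⟨m, hm, rfl⟩ ha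
    exact congrArg (QuotientAddGroup.mk (s := N)) (Mod.smul_ne σ τ h m a hm ha)
  smul_one := by
    rintro σ _ ⟨m, hm, rfl⟩
    exact congrArg (QuotientAddGroup.mk (s := N)) (Mod.smul_one σ m hm)

theorem PseudoLI.eq_zero_of_smul {Mod : GammaMod RG M} {κ : Type*} {β : κ → Γ} {v : κ → M}
    (h : Mod.PseudoLI β v) (i : κ) {a : R} (ha : RG.one (G.src (β i)) * a = a)
    (h0 : Mod.smul (v i) a = 0) : a = 0 := by
  have := h.2 (Finsupp.single i a) (fun j => by
    by_cases hj : j = i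
    · subst hj
      rw [Finsupp.single_eq_same, ha]
    · rw [Finsupp.single_eq_of_ne hj, mul_zero])
    ((Finsupp.sum_single_index (h := fun i r => Mod.smul (v i) r) (Mod.smul_zero _)).trans h0)
  rwa [Finsupp.single_eq_zero] at this

/-- A nonzero pseudo-free module contains a nonzero homogeneous element generating a free
module on one generator. -/
theorem PseudoFree.exists_generator {Mod : GammaMod RG M} (h : Mod.PseudoFree)
    (h0 : ∃ m : M, m ≠ 0) :
    ∃ γ, ∃ x ∈ Mod.grade γ, x ≠ 0 ∧
      ∀ a, RG.one (G.src γ) * a = a → Mod.smul x a = 0 → a = 0 := by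
  obtain ⟨κ, β, v, hLI, hgen⟩ := h
  rcases isEmpty_or_nonempty κ with hκ | ⟨⟨i⟩⟩
  · obtain ⟨m, hm⟩ := h0
    refine absurd ?_ hm
    have : m ∈ (⊤ : AddSubgroup M) := trivial
    rw [← hgen] at this
    simpa using this
  · exact ⟨β i, v i, (hLI.1 i).1, (hLI.1 i).2, fun a => hLI.eq_zero_of_smul i⟩

end GammaMod

namespace GammaRing

variable {Γ : Type u} {G : Gpd Γ} {R : Type v} [NonUnitalRing R] (RG : GammaRing G R)

/-- A nonzero pfm ring has a gr-simple right ideal of the form `R(f)`. -/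
theorem IsPfm.exists_isGrSimpleSub_eComp {RG : GammaRing G R} (h : GammaRing.IsPfm.{u, v, v} RG)
    (h0 : ∃ a : R, a ≠ 0) :
    ∃ f, G.IsObj f ∧ RG.regular.IsGrSimpleSub (RG.regular.eComp f) := by
  obtain ⟨e, he, he1⟩ := RG.exists_one_ne_zero h0
  let N₀ : AddSubgroup R := ⨆ (γ : Γ) (_ : G.tgt γ ≠ e), RG.grade γ
  have hN₀ : RG.regular.IsGradedSub N₀ := by
    constructor
    · intro m hm a
      have : N₀ ≤ (AddMonoidHom.mulLeft (RG.one e)).ker :=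
        iSup₂_le fun γ hγ b hb => RG.one_mul_of_ne he hγ hb
      refine RG.regular.hom_induction (C := fun a => m * a ∈ N₀) a ?_ ?_ ?_
      · intro δ a ha
        have hle : N₀ ≤ N₀.comap (AddMonoidHom.mulRight a) := iSup₂_le fun γ hγ b hb => by
          change b * a ∈ N₀
          by_cases hd : G.src γ = G.tgt δ
          · refine AddSubgroup.mem_iSup_of_mem (G.comp γ δ hd) (AddSubgroup.mem_iSup_of_mem ?_
              (RG.mul_mem γ δ hd b a hb ha))
            rwa [G.tgt_comp]
          · rw [RG.mul_ne γ δ hd b a hb ha]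
            exact AddSubgroup.zero_mem _
        exact hle hm
      · rw [mul_zero]
        exact AddSubgroup.zero_mem _
      · intro x y hx hy
        rw [mul_add]
        exact AddSubgroup.add_mem _ hx hy
    · exact iSup₂_le fun γ hγ b hb => AddSubgroup.mem_iSup_of_mem γ
        ⟨hb, AddSubgroup.mem_iSup_of_mem γ (AddSubgroup.mem_iSup_of_mem hγ hb)⟩
  have hN₀1 : RG.one e ∉ N₀ := by
    intro hmem
    have hle : N₀ ≤ (AddMonoidHom.mulLeft (RG.one e)).ker :=
      iSup₂_le fun γ hγ b hb => RG.one_mul_of_ne he hγ hb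
    have : RG.one e * RG.one e = 0 := hle hmem
    exact he1 (by rwa [RG.one_mul_one he] at this)
  obtain ⟨N, hN₀N, ⟨hN, hN1⟩, hmax⟩ := zorn_le_nonempty₀
    {N : AddSubgroup R | RG.regular.IsGradedSub N ∧ RG.one e ∉ N} (by
      intro c hc hchain y hy
      refine ⟨sSup c, ⟨?_, ?_⟩, fun z hz => le_sSup hz⟩
      · rw [sSup_eq_iSup']
        exact RG.regular.isGradedSub_iSup fun s => (hc s.2).1
      · rw [AddSubgroup.mem_sSup_of_directedOn ⟨y, hy⟩ hchain.directedOn]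
        rintro ⟨s, hs, h1⟩
        exact (hc hs).2 h1) N₀ ⟨hN₀, hN₀1⟩
  have hmk : ∀ a : R, (QuotientAddGroup.mk a : R ⧸ N) = 0 ↔ a ∈ N :=
    fun a => QuotientAddGroup.eq_zero_iff a
  obtain ⟨β, _, ⟨c, hc, rfl⟩, hx0, hinj⟩ :=
    (h ⟨R ⧸ N, RG.regular.quot N hN⟩).exists_generator
      ⟨(QuotientAddGroup.mk (RG.one e) : R ⧸ N), fun h' => hN1 ((hmk _).mp h')⟩
  have hcN : c ∉ N := fun h' => hx0 ((hmk c).mpr h')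
  have hinj' : ∀ a, RG.one (G.src β) * a = a → c * a ∈ N → a = 0 :=
    fun a ha h' => hinj a ha ((hmk (c * a)).mpr h')
  have hβ : G.tgt β = e := by
    by_contra hβ
    exact hcN (hN₀N (AddSubgroup.mem_iSup_of_mem β (AddSubgroup.mem_iSup_of_mem hβ hc)))
  have hf := G.isObj_src β
  have hc1 : c * RG.one (G.src β) = c := RG.mul_one' β c hc
  refine ⟨G.src β, hf, RG.isGradedSub_eComp hf, ?_, fun P hP hPle => ?_⟩
  · intro hbot
    have := RG.one_mem_eComp hf
    rw [hbot, AddSubgroup.mem_bot] at this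
    rw [this, mul_zero] at hc1
    exact hcN (hc1 ▸ N.zero_mem)
  · by_cases h1 : RG.one e ∈ N ⊔ P.map (RG.regular.orbitHom c)
    · right
      refine le_antisymm hPle (RG.eComp_le hf hP ?_)
      have hgr := hN.sup _ (RG.regular.isGradedSub_map_orbitHom hc hP)
      have hcmem : c ∈ N ⊔ P.map (RG.regular.orbitHom c) := by
        have := hgr.1 _ h1 c
        rwa [show RG.regular.smul (RG.one e) c = c from RG.one_mul_of_tgt hβ hc] at this
      obtain ⟨n, hn, _, ⟨p, hp, rfl⟩, hsum⟩ := AddSubgroup.mem_sup.mp hcmem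
      change n + c * p = c at hsum
      have hp1 : RG.one (G.src β) * p = p := (RG.mem_eComp_iff hf).mp (hPle hp)
      have := hinj' (RG.one (G.src β) - p)
        (by rw [mul_sub, hp1, RG.one_mul_one hf])
        (by rwa [mul_sub, hc1, ← eq_sub_of_add_eq hsum])
      rwa [sub_eq_zero.mp this]
    · left
      have hle := hmax ⟨hN.sup _ (RG.regular.isGradedSub_map_orbitHom hc hP), h1⟩ le_sup_left
      refine eq_bot_iff.mpr fun p hp => ?_
      exact hinj' p ((RG.mem_eComp_iff hf).mp (hPle hp))
        (hle (AddSubgroup.mem_sup_right ⟨p, hp, rfl⟩))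

theorem IsGrPrime.isGrSimpleRing {RG : GammaRing G R} (hR : RG.IsGrPrime)
    (h : GammaRing.IsPfm.{u, v, v} RG) {f : Γ} (hf : G.IsObj f)
    (hS : RG.regular.IsGrSimpleSub (RG.regular.eComp f)) : RG.IsGrSimpleRing := by
  have hJ := RG.isGradedIdeal_oneIdeal hf
  have hne : ∀ g, G.IsObj g → RG.one g ≠ 0 → RG.oneIdeal g ≠ ⊥ := fun g hg h1 hbot => h1 (by
    have := RG.one_mem_oneIdeal hg
    rwa [hbot, AddSubgroup.mem_bot] at this)
  have hJ0 := hne f hf (RG.one_ne_zero_of_isGrSimpleSub hf hS)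
  have hJtop : RG.oneIdeal f = ⊤ := by
    by_contra htop
    obtain ⟨r, hr⟩ : ∃ r, r ∉ RG.oneIdeal f := by
      by_contra! hc
      exact htop (eq_top_iff.mpr fun a _ => hc a)
    have hmk : ∀ a : R, (QuotientAddGroup.mk a : R ⧸ RG.oneIdeal f) = 0 ↔ a ∈ RG.oneIdeal f :=
      fun a => QuotientAddGroup.eq_zero_iff a
    obtain ⟨γ, _, ⟨c, hc, rfl⟩, hx0, hinj⟩ :=
      (h ⟨R ⧸ RG.oneIdeal f, RG.regular.quot _ hJ.isGradedSub⟩).exists_generator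
        ⟨(QuotientAddGroup.mk r : R ⧸ RG.oneIdeal f), fun h' => hr ((hmk _).mp h')⟩
    have hg := G.isObj_src γ
    have hann : ∀ a ∈ RG.oneIdeal f, RG.one (G.src γ) * a = 0 := fun a ha =>
      hinj _ (by rw [← mul_assoc, RG.one_mul_one hg])
        ((hmk (c * (RG.one (G.src γ) * a))).mpr (hJ.1 _ (hJ.1 a ha _).2 c).2)
    have hg1 : RG.one (G.src γ) ≠ 0 := by
      intro h1
      refine hx0 ((hmk c).mpr ?_)
      rw [← RG.mul_one' γ c hc, h1, mul_zero]
      exact AddSubgroup.zero_mem _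
    obtain ⟨a, ha, b, hb, hab⟩ := hR.2 _ _ (RG.isGradedIdeal_oneIdeal hg) hJ (hne _ hg hg1) hJ0
    refine hab ((RG.oneIdeal_le (N := (AddMonoidHom.mulRight b).ker) fun r s => ?_) ha)
    change r * RG.one (G.src γ) * s * b = 0
    rw [mul_assoc _ s b, mul_assoc r, hann _ (hJ.1 b hb s).2, mul_zero]
  refine ⟨hR.1, fun I hI => or_iff_not_imp_left.mpr fun hI0 => ?_⟩
  obtain ⟨a, ha, b, hb, hab⟩ := hR.2 _ _ hJ hI hJ0 hI0
  have hex : ∃ s, RG.one f * (s * b) ≠ 0 := by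
    by_contra! hc
    refine hab ((RG.oneIdeal_le (N := (AddMonoidHom.mulRight b).ker) fun r s => ?_) ha)
    change r * RG.one f * s * b = 0
    rw [mul_assoc _ s b, mul_assoc r, hc, mul_zero]
  obtain ⟨s, hs⟩ := hex
  have hinf := (RG.isGradedSub_eComp hf).inf _ hI.isGradedSub
  have hIf : RG.regular.eComp f ⊓ I = RG.regular.eComp f := by
    refine (hS.2.2 _ hinf inf_le_left).resolve_left fun hbot => hs ?_
    have : RG.one f * (s * b) ∈ RG.regular.eComp f ⊓ I :=
      ⟨(RG.mem_eComp_iff hf).mpr (by rw [← mul_assoc, RG.one_mul_one hf]),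
        (hI.1 _ (hI.1 b hb s).2 _).2⟩
    rwa [hbot] at this
  have h1 : RG.one f ∈ I := inf_eq_left.mp hIf (RG.one_mem_eComp hf)
  rw [eq_top_iff, ← hJtop]
  exact RG.oneIdeal_le fun a b => (hI.1 _ (hI.1 _ h1 a).2 b).1

theorem exists_right_inv_of_isGrSimpleSub {e : Γ} (he : G.IsObj e)
    (hS : RG.regular.IsGrSimpleSub (RG.regular.eComp e)) {γ : Γ} (hγ : G.src γ = e)
    (hγ' : G.tgt γ = e) {a : R} (ha : a ∈ RG.grade γ) (ha0 : a ≠ 0) :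
    ∃ b ∈ RG.grade (G.inv γ), b ≠ 0 ∧ a * b = RG.one e := by
  have hgr := RG.regular.isGradedSub_map_orbitHom ha RG.regular.isGradedSub_top
  have hle : (⊤ : AddSubgroup R).map (RG.regular.orbitHom a) ≤ RG.regular.eComp e := by
    rintro _ ⟨b, -, rfl⟩
    rw [RG.mem_eComp_iff he]
    change RG.one e * (a * b) = a * b
    rw [← mul_assoc, RG.one_mul_of_tgt hγ' ha]
  rcases hS.2.2 _ hgr hle with h | h
  · have : a * RG.one e ∈ (⊤ : AddSubgroup R).map (RG.regular.orbitHom a) :=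
      ⟨_, trivial, rfl⟩
    rw [h, RG.mul_one_of_src hγ ha] at this
    exact absurd this ha0
  · have h1 := RG.one_mem_eComp he
    rw [← h] at h1
    obtain ⟨b, -, hb⟩ := h1
    have hmul : a * RG.regular.proj (G.inv γ) b = RG.one e := by
      have := RG.regular.proj_smul (G.tgt_inv γ).symm ha b
      rw [show RG.regular.smul a b = RG.one e from hb, G.comp_inv, hγ',
        RG.regular.proj_of_mem (RG.one_mem e he)] at this
      exact this.symm
    refine ⟨_, RG.regular.proj_mem _ b, fun h0 => ?_, hmul⟩
    rw [h0, mul_zero] at hmul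
    exact RG.one_ne_zero_of_isGrSimpleSub he hS hmul.symm

theorem exists_inv_of_isGrSimpleSub {e : Γ} (he : G.IsObj e)
    (hS : RG.regular.IsGrSimpleSub (RG.regular.eComp e)) {γ : Γ} (hγ : G.src γ = e)
    (hγ' : G.tgt γ = e) {a : R} (ha : a ∈ RG.grade γ) (ha0 : a ≠ 0) :
    ∃ b ∈ RG.grade (G.inv γ), a * b = RG.one e ∧ b * a = RG.one e := by
  obtain ⟨b, hb, hb0, hab⟩ := RG.exists_right_inv_of_isGrSimpleSub he hS hγ hγ' ha ha0
  obtain ⟨c, hc, -, hbc⟩ := RG.exists_right_inv_of_isGrSimpleSub he hS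
    ((G.src_inv γ).trans hγ') ((G.tgt_inv γ).trans hγ) hb hb0
  refine ⟨b, hb, hab, ?_⟩
  rw [G.inv_inv] at hc
  have hac : a = c := by
    rw [← RG.mul_one_of_src hγ ha, ← hbc, ← mul_assoc, hab, RG.one_mul_of_tgt hγ' hc]
  rw [hac, hbc]

theorem componentDivisionRing_of_isGrSimpleSub {e : Γ} (he : G.IsObj e)
    (hS : RG.regular.IsGrSimpleSub (RG.regular.eComp e)) : RG.ComponentDivisionRing e := by
  refine ⟨RG.one_ne_zero_of_isGrSimpleSub he hS, fun a ha ha0 => ?_⟩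
  have := RG.exists_inv_of_isGrSimpleSub he hS he he.tgt_eq ha ha0
  rwa [he.inv_eq] at this

theorem isGrSimpleSub_of_componentDivisionRing (hR : RG.IsGrSimpleRing)
    (hA : RG.IsRightGamma0Artinian) {e : Γ} (he : G.IsObj e)
    (hD : RG.ComponentDivisionRing e) : RG.regular.IsGrSimpleSub (RG.regular.eComp e) := by
  have hcomp : G.src e = G.tgt e := he.trans he.tgt_eq.symm
  have hne : RG.regular.eComp e ≠ ⊥ := fun hbot => hD.1 (by
    have := RG.one_mem_eComp he
    rwa [hbot, AddSubgroup.mem_bot] at this)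
  obtain ⟨S, ⟨hS, hSle, hS0⟩, hmin⟩ : ∃ S : AddSubgroup R,
      (RG.regular.IsGradedSub S ∧ S ≤ RG.regular.eComp e ∧ S ≠ ⊥) ∧
      ∀ P : AddSubgroup R, RG.regular.IsGradedSub P → P ≤ S → P ≠ ⊥ → P = S := by
    by_contra! hc
    let T := {S : AddSubgroup R // RG.regular.IsGradedSub S ∧ S ≤ RG.regular.eComp e ∧ S ≠ ⊥}
    have hstep : ∀ S : T, ∃ P : T, P.1 < S.1 := fun S => by
      obtain ⟨P, hP, hPle, hP0, hPne⟩ := hc S.1 S.2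
      exact ⟨⟨P, hP, hPle.trans S.2.2.1, hP0⟩, lt_of_le_of_ne hPle hPne⟩
    choose next hnext using hstep
    let f : ℕ → T := fun n => next^[n] ⟨_, RG.isGradedSub_eComp he, le_rfl, hne⟩
    have hf : ∀ n, (f (n + 1)).1 < (f n).1 := fun n => by
      simp only [f, Function.iterate_succ_apply']
      exact hnext _
    obtain ⟨n, hn⟩ := hA e he (fun n => (f n).1) (fun n => ⟨(f n).2.1, (f n).2.2.1⟩)
      (fun n => (hf n).le)
    exact (hf n).ne (hn (n + 1) (Nat.le_succ n))
  obtain ⟨x, hxS, hxS0⟩ : ∃ x ∈ S, ∃ z ∈ S, x * z ≠ 0 := by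
    by_contra! hc
    let I : AddSubgroup R := AddSubgroup.closure {r | ∃ a : R, ∃ s ∈ S, r = a * s}
    have hIle : ∀ N : AddSubgroup R, (∀ a : R, ∀ s ∈ S, a * s ∈ N) → I ≤ N := fun N hN => by
      rw [AddSubgroup.closure_le]
      rintro _ ⟨a, s, hs, rfl⟩
      exact hN a s hs
    have hmem : ∀ a : R, ∀ s ∈ S, a * s ∈ I := fun a s hs =>
      AddSubgroup.subset_closure ⟨a, s, hs, rfl⟩
    have hI : RG.IsGradedIdeal I := by
      refine ⟨fun a ha r => ⟨?_, ?_⟩, hIle _ fun a s hs => ?_⟩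
      · exact hIle (I.comap (AddMonoidHom.mulRight r)) (fun a s hs => by
          change a * s * r ∈ I
          rw [mul_assoc]
          exact hmem _ _ (hS.1 s hs r)) ha
      · exact hIle (I.comap (AddMonoidHom.mulLeft r)) (fun a s hs => by
          change r * (a * s) ∈ I
          rw [← mul_assoc]
          exact hmem _ _ hs) ha
      · refine RG.regular.hom_induction (C := fun a => a * s ∈ ⨆ γ, (RG.grade γ ⊓ I)) a ?_ ?_ ?_
        · intro γ a ha
          exact (RG.regular.isGradedSub_map_orbitHom ha hS).2.trans
            (iSup_mono fun δ => inf_le_inf_left _ (by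
              rintro _ ⟨s, hs, rfl⟩
              exact hmem a s hs)) ⟨s, hs, rfl⟩
        · rw [zero_mul]
          exact AddSubgroup.zero_mem _
        · intro x y hx hy
          rw [add_mul]
          exact AddSubgroup.add_mem _ hx hy
    have hI0 : I ≠ ⊥ := fun hbot => hS0 (eq_bot_iff.mpr fun s hs => by
      have := hmem (RG.one e) s hs
      rwa [hbot, (RG.mem_eComp_iff he).mp (hSle hs)] at this)
    obtain ⟨a, ha, b, hb, hab⟩ := hR.isGrPrime.2 I I hI hI hI0 hI0
    refine hab (hIle (AddMonoidHom.mulRight b).ker (fun r s hs => ?_) ha)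
    refine hIle (AddMonoidHom.mulLeft (r * s)).ker (fun r' s' hs' => ?_) hb
    change r * s * (r' * s') = 0
    rw [mul_assoc, ← mul_assoc s, show s * r' * s' = 0 from hc _ (hS.1 s hs r') s' hs', mul_zero]
  obtain ⟨z₀, hz₀S, hxz₀⟩ := hxS0
  obtain ⟨γ, x', hx', hmem_x, z₁, hz₁S, hxz₁⟩ : ∃ γ, ∃ x' ∈ RG.grade γ, x' ∈ S ∧
      ∃ z ∈ S, x' * z ≠ 0 := by
    by_contra! hc
    refine hxz₀ ?_
    have hle : S ≤ (AddMonoidHom.mulRight z₀).ker := hS.2.trans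
      (iSup_le fun γ y hy => hc γ y hy.1 hy.2 z₀ hz₀S)
    exact hle hxS
  have hsrc : G.src γ = e := by
    by_contra hsrc
    refine hxz₁ ?_
    rw [← (RG.mem_eComp_iff he).mp (hSle hz₁S), ← mul_assoc, RG.mul_one_of_ne he hsrc hx',
      zero_mul]
  have hγe : G.src γ = G.tgt e := hsrc.trans he.tgt_eq.symm
  have hxS' : S.map (RG.regular.orbitHom x') = S := by
    refine hmin _ (RG.regular.isGradedSub_map_orbitHom hx' hS) ?_ fun hbot => hxz₁ ?_
    · rintro _ ⟨s, -, rfl⟩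
      exact hS.1 x' hmem_x s
    · have : x' * z₁ ∈ S.map (RG.regular.orbitHom x') := ⟨z₁, hz₁S, rfl⟩
      rwa [hbot] at this
  obtain ⟨z, hz, hxz⟩ : x' ∈ S.map (RG.regular.orbitHom x') := by rwa [hxS']
  have hproj : x' * RG.regular.proj e z = x' := by
    have := RG.regular.proj_smul hγe hx' z
    rw [show RG.regular.smul x' z = x' from hxz, G.comp_eq_left he hγe,
      RG.regular.proj_of_mem hx'] at this
    exact this.symm
  have hz0 : RG.regular.proj e z ≠ 0 := by
    intro h0
    rw [h0, mul_zero] at hproj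
    exact hxz₁ (by rw [← hproj, zero_mul])
  obtain ⟨b, -, hb, -⟩ := hD.2 _ (RG.regular.proj_mem e z) hz0
  have h1 : RG.one e ∈ S := by
    rw [← hb]
    exact hS.1 _ (RG.regular.proj_mem_of_mem hS.2 hz e) b
  have hSeq : S = RG.regular.eComp e := le_antisymm hSle (RG.eComp_le he hS h1)
  rw [← hSeq]
  exact ⟨hS, hS0, fun P hP hPS => or_iff_not_imp_left.mpr (hmin P hP hPS)⟩

end GammaRing

namespace GammaMod

variable {Γ : Type u} {G : Gpd Γ} {R : Type v} [NonUnitalRing R] {RG : GammaRing G R}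
  {M : Type w} [AddCommGroup M] (Mod : GammaMod RG M)

theorem span_le {B : Set M} {P : AddSubgroup M} (h : ∀ x ∈ B, ∀ a, Mod.smul x a ∈ P) :
    Mod.span B ≤ P :=
  iSup_le fun x => by
    rintro _ ⟨a, -, rfl⟩
    exact h x x.2 a

/-- Finite sums of copies of a gr-simple module satisfy the descending chain condition. -/
theorem exists_eventually_eq_of_le_span {e : Γ} (he : G.IsObj e)
    (hS : RG.regular.IsGrSimpleSub (RG.regular.eComp e)) (t : Finset M)
    (ht : (t : Set M) ⊆ Mod.sourceSet e) {f : ℕ → AddSubgroup M}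
    (hf : ∀ n, Mod.IsGradedSub (f n)) (hft : ∀ n, f n ≤ Mod.span t) (hanti : Antitone f) :
    ∃ n, ∀ k, n ≤ k → f k = f n := by
  classical
  induction t using Finset.induction_on generalizing f with
  | empty =>
    have hbot : ∀ n, f n = ⊥ := fun n => eq_bot_iff.mpr ((hft n).trans
      (Mod.span_le (by simp)))
    exact ⟨0, fun k _ => by rw [hbot, hbot]⟩
  | insert b t _ ih =>
    have htX : (t : Set M) ⊆ Mod.sourceSet e := fun x hx => ht (by simp [Finset.mem_coe.mp hx])
    obtain ⟨-, γ, hγ, hb⟩ : b ∈ Mod.sourceSet e := ht (by simp)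
    have hP := Mod.isGradedSub_span htX
    obtain ⟨n, hn⟩ := ih htX (f := fun k => f k ⊓ Mod.span t) (fun k => (hf k).inf _ hP)
      (fun k => inf_le_right) (fun k l hkl => inf_le_inf_right _ (hanti hkl))
    by_cases hall : ∀ k, b ∈ f k ⊔ Mod.span t
    · refine ⟨n, fun k hk => eq_of_le_of_inf_le_of_sup_le (hanti hk) (hn k hk).ge ?_⟩
      have htop : Mod.span (insert b t : Finset M) ≤ f k ⊔ Mod.span t := by
        refine Mod.span_le fun x hx a => ?_
        rw [Finset.coe_insert] at hx
        rcases hx with rfl | hx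
        · exact ((hf k).sup _ hP).1 x (hall k) a
        · exact AddSubgroup.mem_sup_right (Mod.smul_mem_span hx a)
      exact sup_le ((hft n).trans htop) le_sup_right
    · push Not at hall
      obtain ⟨m, hm⟩ := hall
      have hle : ∀ k, m ≤ k → f k ≤ Mod.span t := fun k hk y hy => by
        have hins : Mod.span (insert b t : Finset M) ≤
            (⊤ : AddSubgroup R).map (Mod.orbitHom b) ⊔ Mod.span t := Mod.span_le fun x hx a => by
          rw [Finset.coe_insert] at hx
          rcases hx with rfl | hx
          · exact AddSubgroup.mem_sup_left ⟨a, trivial, rfl⟩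
          · exact AddSubgroup.mem_sup_right (Mod.smul_mem_span hx a)
        obtain ⟨_, ⟨a, -, rfl⟩, p, hp, hsum⟩ := AddSubgroup.mem_sup.mp (hins (hft k hy))
        change Mod.smul b a + p = y at hsum
        have hba : Mod.smul b (RG.one e * a) = Mod.smul b a := by
          rw [Mod.smul_mul, Mod.smul_one_of_src hγ hb]
        have h0 := ((Mod.mem_or_eq_zero_of_smul_mem he hS hb hγ ((hf m).sup _ hP)).resolve_left hm)
          (RG.one e * a) (by rw [← mul_assoc, RG.one_mul_one he]) (by
            rw [hba, eq_sub_of_add_eq hsum]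
            exact AddSubgroup.sub_mem _ (AddSubgroup.mem_sup_left (hanti hk hy))
              (AddSubgroup.mem_sup_right hp))
        rw [← hsum, ← hba, h0, Mod.smul_zero, zero_add]
        exact hp
      refine ⟨max m n, fun k hk => ?_⟩
      have h1 := hn k ((le_max_right _ _).trans hk)
      have h2 := hn (max m n) (le_max_right _ _)
      simp only [inf_eq_left.mpr (hle _ ((le_max_left m n).trans hk))] at h1
      simp only [inf_eq_left.mpr (hle _ (le_max_left m n))] at h2
      rw [h1, h2]

end GammaMod

theorem GammaRing.isRightGamma0Artinian_of_isGrSimpleSub {Γ : Type u} {G : Gpd Γ} {R : Type v}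
    [NonUnitalRing R] (RG : GammaRing G R) {e : Γ} (he : G.IsObj e) (hR : RG.IsGrSimpleRing)
    (hS : RG.regular.IsGrSimpleSub (RG.regular.eComp e)) : RG.IsRightGamma0Artinian := by
  intro f hf g hg hanti
  obtain ⟨B, hBX, -, hB⟩ := RG.regular.exists_indepSet_span_eq_top he hR hS
  obtain ⟨c, hcB, -, hc⟩ := RG.regular.exists_sum_of_mem_span he hBX (m := RG.one f)
    (by rw [hB]; trivial)
  refine RG.regular.exists_eventually_eq_of_le_span he hS c.support (hcB.trans hBX)
    (fun n => (hg n).1) (fun n => (hg n).2.trans fun r hr => ?_) (antitone_nat_of_succ_le hanti)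
  have hgr := (RG.regular.isGradedSub_span (hcB.trans hBX)).1 _
    (RG.regular.sum_mem_span (c := c) subset_rfl) r
  rw [← hc] at hgr
  rwa [show RG.regular.smul (RG.one f) r = r from (RG.mem_eComp_iff hf).mp hr] at hgr

/-- A homogeneous basis `x` of the right module `R`, with degrees of source `e`, together with
its dual basis `y`; `t f` is the finite set of those indices whose degree has target `f`. -/
structure GammaRing.DualBasis {Γ : Type u} {G : Gpd Γ} {R : Type v} [NonUnitalRing R]
    (RG : GammaRing G R) (e : Γ) (I : Type w) where
  deg : I → Γ
  x : I → R
  y : I → R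
  t : Γ → Finset I
  src_deg : ∀ i, G.src (deg i) = e
  x_mem : ∀ i, x i ∈ RG.grade (deg i)
  y_mem : ∀ i, y i ∈ RG.grade (G.inv (deg i))
  mem_t : ∀ i f, i ∈ t f ↔ G.tgt (deg i) = f
  y_mul_x_self : ∀ i, y i * x i = RG.one e
  y_mul_x_ne : ∀ i j, i ≠ j → y i * x j = 0
  sum_x_mul_y : ∀ f, G.IsObj f → ∑ i ∈ t f, x i * y i = RG.one f

theorem GammaRing.exists_dualBasis {Γ : Type u} {G : Gpd Γ} {R : Type v} [NonUnitalRing R]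
    (RG : GammaRing G R) {e : Γ} (he : G.IsObj e) (hR : RG.IsGrSimpleRing)
    (hS : RG.regular.IsGrSimpleSub (RG.regular.eComp e)) :
    ∃ I : Type v, Nonempty (RG.DualBasis e I) := by
  classical
  obtain ⟨B, hBX, hBI, hB⟩ := RG.regular.exists_indepSet_span_eq_top he hR hS
  choose β hβe hβ using fun i : B => (hBX i.2).2
  choose c hcB hce hc using fun f => RG.regular.exists_sum_of_mem_span he hBX (m := RG.one f)
    (by rw [hB]; trivial)
  let t : Γ → Finset B := fun f => ((c f).support.subtype (· ∈ B)).filter (fun i => G.tgt (β i) = f)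
  let y : B → R := fun i => RG.regular.proj (G.inv (β i)) (c (G.tgt (β i)) i)
  have hymem : ∀ i, y i ∈ RG.grade (G.inv (β i)) := fun i => RG.regular.proj_mem _ _
  have htgt : ∀ {i f}, i ∈ t f → G.tgt (β i) = f := fun h => (Finset.mem_filter.mp h).2
  have hsum : ∀ f, G.IsObj f → ∑ i ∈ t f, (i : R) * y i = RG.one f := by
    intro f hf
    have h1 : RG.one f = ∑ i ∈ t f, (i : R) * c f i := by
      have hmul : ∀ i : B, RG.one f * ((i : R) * c f i)
          = if G.tgt (β i) = f then (i : R) * c f i else 0 := fun i => by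
        rw [← mul_assoc]
        split_ifs with h
        · rw [RG.one_mul_of_tgt h (hβ i)]
        · rw [RG.one_mul_of_ne hf h (hβ i), zero_mul]
      rw [Finset.sum_filter, ← Finset.sum_congr rfl fun i _ => hmul i, ← Finset.mul_sum,
        Finset.sum_subtype_of_mem (fun m => m * c f m) (hcB f)]
      conv_lhs => rw [← RG.one_mul_one hf]
      exact congrArg (RG.one f * ·) (hc f)
    have h2 := congrArg (RG.regular.proj f) h1
    rw [RG.regular.proj_of_mem (RG.one_mem f hf), map_sum] at h2
    rw [h2]
    refine Finset.sum_congr rfl fun i hi => ?_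
    have := RG.regular.proj_smul (G.tgt_inv (β i)).symm (hβ i) (c f i)
    rw [G.comp_inv, htgt hi] at this
    rw [show RG.regular.proj f ((i : R) * c f i) = _ from this]
    simp only [y, htgt hi]
    rfl
  have horth : ∀ i, i ∈ t (G.tgt (β i)) ∧ ∀ k, y k * (i : R) = if k = i then RG.one e else 0 := by
    intro i
    have h0 := hBI.eq_zero_of_sum (Function.Embedding.subtype (· ∈ B)) (fun i => i.2)
      (c := Finsupp.indicator (t (G.tgt (β i))) (fun j _ => y j * (i : R))
        - Finsupp.single i (RG.one e)) ?_ ?_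
    · have hk : ∀ k, (if k ∈ t (G.tgt (β i)) then y k * (i : R) else 0)
          = if k = i then RG.one e else 0 := by
        intro k
        have := DFunLike.congr_fun (sub_eq_zero.mp h0) k
        simpa [Finsupp.indicator_apply, Finsupp.single_apply, eq_comm (a := k)] using this
      have hi : i ∈ t (G.tgt (β i)) := by
        by_contra hi
        have := hk i
        rw [if_neg hi, if_pos rfl] at this
        exact RG.one_ne_zero_of_isGrSimpleSub he hS this.symm
      refine ⟨hi, fun k => ?_⟩
      rw [← hk k]
      split_ifs with hkt
      · rfl
      · by_cases hkf : G.tgt (β k) = G.tgt (β i)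
        · have : c (G.tgt (β i)) k = 0 := by
            by_contra hne
            exact hkt (by simp [t, hkf, hne])
          simp only [y, hkf, this, map_zero, zero_mul]
        · exact RG.mul_ne _ _ (by rwa [G.src_inv]) _ _ (hymem k) (hβ i)
    · intro k
      rw [Finsupp.sub_apply, mul_sub, Finsupp.indicator_apply, Finsupp.single_apply]
      congr 1
      · split_ifs
        · rw [← mul_assoc, RG.one_mul_of_tgt ((G.tgt_inv _).trans (hβe k)) (hymem k)]
        · rw [mul_zero]
      · split_ifs
        · rw [RG.one_mul_one he]
        · rw [mul_zero]
    · refine (Finsupp.sum_sub_index (fun _ => RG.regular.smul_sub _)).trans (sub_eq_zero.mpr ?_)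
      refine (Finsupp.sum_indicator_index (h := fun j : B => RG.regular.smul (j : R)) _
        (fun _ _ => RG.regular.smul_zero _)).trans (Eq.trans ?_ (Finsupp.sum_single_index
          (h := fun j : B => RG.regular.smul (j : R)) (RG.regular.smul_zero _)).symm)
      refine Eq.trans ?_ (RG.regular.smul_one_of_src (hβe i) (hβ i)).symm
      refine Eq.trans ?_ (RG.one_mul' _ _ (hβ i))
      rw [← hsum _ (G.isObj_tgt _), Finset.sum_mul]
      exact Finset.sum_congr rfl fun j _ => (mul_assoc _ _ _).symm
  exact ⟨B, ⟨{
    deg := β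
    x := (↑)
    y := y
    t := t
    src_deg := hβe
    x_mem := hβ
    y_mem := hymem
    mem_t := fun i f => ⟨htgt, fun h => h ▸ (horth i).1⟩
    y_mul_x_self := fun i => by rw [(horth i).2, if_pos rfl]
    y_mul_x_ne := fun i j h => by rw [(horth j).2, if_neg h]
    sum_x_mul_y := hsum }⟩⟩

namespace GammaRing

variable {Γ : Type u} {G : Gpd Γ} {R : Type v} [NonUnitalRing R] (RG : GammaRing G R)

theorem proj_one_mul {e : Γ} (he : G.IsObj e) (γ : Γ) (a : R) :
    RG.regular.proj γ (RG.one e * a) = RG.one e * RG.regular.proj γ a := by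
  refine RG.regular.hom_induction (C := fun a =>
    RG.regular.proj γ (RG.one e * a) = RG.one e * RG.regular.proj γ a) a ?_ (by simp) ?_
  · intro δ a ha
    have hor : RG.one e * a = a ∨ RG.one e * a = 0 := by
      by_cases h : G.tgt δ = e
      · exact Or.inl (RG.one_mul_of_tgt h ha)
      · exact Or.inr (RG.one_mul_of_ne he h ha)
    by_cases hγ : γ = δ
    · subst hγ
      rw [RG.regular.proj_of_mem ha]
      rcases hor with h | h
      · rw [h, RG.regular.proj_of_mem ha]
      · rw [h, map_zero]
    · rw [RG.regular.proj_of_ne hγ ha, mul_zero]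
      rcases hor with h | h
      · rw [h, RG.regular.proj_of_ne hγ ha]
      · rw [h, map_zero]
  · intro a b ha hb
    rw [mul_add, map_add, map_add, mul_add, ha, hb]

theorem proj_mul_one {e : Γ} (he : G.IsObj e) (γ : Γ) (a : R) :
    RG.regular.proj γ (a * RG.one e) = RG.regular.proj γ a * RG.one e := by
  refine RG.regular.hom_induction (C := fun a =>
    RG.regular.proj γ (a * RG.one e) = RG.regular.proj γ a * RG.one e) a ?_ (by simp) ?_
  · intro δ a ha
    have hor : a * RG.one e = a ∨ a * RG.one e = 0 := by
      by_cases h : G.src δ = e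
      · exact Or.inl (RG.mul_one_of_src h ha)
      · exact Or.inr (RG.mul_one_of_ne he h ha)
    by_cases hγ : γ = δ
    · subst hγ
      rw [RG.regular.proj_of_mem ha]
      rcases hor with h | h
      · rw [h, RG.regular.proj_of_mem ha]
      · rw [h, map_zero]
    · rw [RG.regular.proj_of_ne hγ ha, zero_mul]
      rcases hor with h | h
      · rw [h, RG.regular.proj_of_ne hγ ha]
      · rw [h, map_zero]
  · intro a b ha hb
    rw [add_mul, map_add, map_add, add_mul, ha, hb]

/-- The corner ring `1_e R 1_e`. -/
def corner (e : Γ) : NonUnitalSubring R where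
  carrier := {x | RG.one e * x = x ∧ x * RG.one e = x}
  add_mem' ha hb := ⟨by rw [mul_add, ha.1, hb.1], by rw [add_mul, ha.2, hb.2]⟩
  zero_mem' := ⟨mul_zero _, zero_mul _⟩
  mul_mem' ha hb := ⟨by rw [← mul_assoc, ha.1], by rw [mul_assoc, hb.2]⟩
  neg_mem' ha := ⟨by rw [mul_neg, ha.1], by rw [neg_mul, ha.2]⟩

theorem eq_zero_or_of_mem_corner {e γ : Γ} (he : G.IsObj e) {a : R} (ha : a ∈ RG.corner e)
    (hγ : a ∈ RG.grade γ) : a = 0 ∨ G.src γ = e ∧ G.tgt γ = e := by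
  by_cases h₁ : G.src γ = e
  · by_cases h₂ : G.tgt γ = e
    · exact Or.inr ⟨h₁, h₂⟩
    · exact Or.inl (by rw [← ha.1, RG.one_mul_of_ne he h₂ hγ])
  · exact Or.inl (by rw [← ha.2, RG.mul_one_of_ne he h₁ hγ])

/-- The inclusion of the corner ring. -/
def cornerVal (e : Γ) : RG.corner e →+ R :=
  AddMonoidHomClass.toAddMonoidHom (NonUnitalSubringClass.subtype (RG.corner e))

open scoped Classical in
/-- The graded ring structure on the corner ring `1_e R 1_e`. -/
noncomputable def cornerRing {e : Γ} (he : G.IsObj e) : GammaRing G (RG.corner e) where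
  grade γ := (RG.grade γ).comap (RG.cornerVal e)
  grade_iSup := by
    refine eq_top_iff.mpr fun z _ => ?_
    have hz : (z : R) ∈ (⨆ γ, (RG.grade γ).comap
        (RG.cornerVal e)).map
        (RG.cornerVal e) := by
      have hle : ∀ N : AddSubgroup R, ⨆ γ, (RG.regular.grade γ ⊓ N) ≤ N := fun N =>
        iSup_le fun _ => inf_le_right
      refine hle _ (RG.regular.mem_of_proj_mem fun γ => ?_)
      refine ⟨⟨RG.regular.proj γ z, ?_, ?_⟩, ?_, rfl⟩
      · rw [← RG.proj_one_mul he, z.2.1]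
      · rw [← RG.proj_mul_one he, z.2.2]
      · exact AddSubgroup.mem_iSup_of_mem γ (RG.regular.proj_mem γ (z : R))
    obtain ⟨z', hz', h⟩ := hz
    rwa [← Subtype.ext h]
  grade_indep γ := by
    rw [eq_bot_iff]
    rintro z ⟨hz, hz'⟩
    have hle : (⨆ (δ : Γ) (_ : δ ≠ γ), (RG.grade δ).comap (RG.cornerVal e))
        ≤ (⨆ (δ : Γ) (_ : δ ≠ γ), RG.grade δ).comap (RG.cornerVal e) :=
      iSup₂_le fun δ hδ => AddSubgroup.comap_mono (le_iSup₂_of_le δ hδ le_rfl)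
    have : (z : R) ∈ RG.grade γ ⊓ (⨆ (δ : Γ) (_ : δ ≠ γ), RG.grade δ) := ⟨hz, hle hz'⟩
    rw [RG.grade_indep] at this
    exact Subtype.ext this
  mul_mem γ δ h a b ha hb := RG.mul_mem γ δ h a b ha hb
  mul_ne γ δ h a b ha hb := Subtype.ext (RG.mul_ne γ δ h a b ha hb)
  one f := if f = e then ⟨RG.one e, RG.one_mul_one he, RG.one_mul_one he⟩ else 0
  one_mem f _ := by
    split_ifs with h
    · subst h
      exact RG.one_mem f he
    · exact AddSubgroup.zero_mem _
  one_mul' γ a ha := by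
    rcases RG.eq_zero_or_of_mem_corner he a.2 ha with h | ⟨-, h⟩
    · rw [show a = 0 from Subtype.ext h, mul_zero]
    · rw [if_pos h]
      exact Subtype.ext a.2.1
  mul_one' γ a ha := by
    rcases RG.eq_zero_or_of_mem_corner he a.2 ha with h | ⟨h, -⟩
    · rw [show a = 0 from Subtype.ext h, zero_mul]
    · rw [if_pos h]
      exact Subtype.ext a.2.2

theorem cornerRing_one {e : Γ} (he : G.IsObj e) :
    ((RG.cornerRing he).one e : R) = RG.one e := by
  simp [cornerRing]

theorem suppLE_cornerRing {e : Γ} (he : G.IsObj e) : (RG.cornerRing he).SuppLE e := by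
  intro γ hγ
  obtain ⟨a, ha0⟩ := AddSubgroup.ne_bot_iff_exists_ne_zero.mp hγ
  exact (RG.eq_zero_or_of_mem_corner he a.1.2 a.2).resolve_left fun h =>
    ha0 (Subtype.ext (Subtype.ext h))

theorem isGrDivision_cornerRing {e : Γ} (he : G.IsObj e)
    (hS : RG.regular.IsGrSimpleSub (RG.regular.eComp e)) : (RG.cornerRing he).IsGrDivision := by
  refine ⟨⟨⟨RG.one e, RG.one_mul_one he, RG.one_mul_one he⟩, fun h =>
    RG.one_ne_zero_of_isGrSimpleSub he hS (congrArg Subtype.val h)⟩, fun γ a ha ha0 => ?_⟩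
  obtain ⟨hs, ht⟩ := (RG.eq_zero_or_of_mem_corner he a.2 ha).resolve_left fun h =>
    ha0 (Subtype.ext h)
  obtain ⟨b, hb, hab, hba⟩ := RG.exists_inv_of_isGrSimpleSub he hS hs ht ha
    fun h => ha0 (Subtype.ext h)
  refine ⟨⟨b, RG.one_mul_of_tgt ((G.tgt_inv γ).trans hs) hb,
    RG.mul_one_of_src ((G.src_inv γ).trans ht) hb⟩, hb, ?_, ?_⟩
  · exact Subtype.ext (hab.trans (by rw [ht, RG.cornerRing_one he]))
  · exact Subtype.ext (hba.trans (by rw [hs, RG.cornerRing_one he]))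

end GammaRing

section EntryGrade

variable {Γ : Type u} {G : Gpd Γ} {D : Type x} [NonUnitalRing D] (DG : GammaRing G D)
  {I : Type w} {σ : I → Γ} {γ : Γ} {i j : I}

theorem entryGrade_eq_grade (h₁ : G.src (σ i) = G.tgt γ)
    (h₂ : G.src (G.comp (σ i) γ h₁) = G.tgt (G.inv (σ j))) :
    entryGrade G DG σ γ i j = DG.grade (G.comp (G.comp (σ i) γ h₁) (G.inv (σ j)) h₂) := by
  rw [entryGrade, G.conj?_eq_some h₁ h₂]
  rfl

theorem entryGrade_eq_bot (h : ¬ (G.src (σ i) = G.tgt γ ∧ G.src γ = G.src (σ j))) :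
    entryGrade G DG σ γ i j = ⊥ := by
  rw [entryGrade]
  by_cases h₁ : G.src (σ i) = G.tgt γ
  · rw [G.conj?_eq_none_right fun h₂ => h ⟨h₁, h₂⟩]
    rfl
  · rw [G.conj?_eq_none_left h₁]
    rfl

end EntryGrade

namespace GammaRing.DualBasis

variable {Γ : Type u} {G : Gpd Γ} {R : Type v} [NonUnitalRing R] {RG : GammaRing G R} {e : Γ}
  {I : Type w} (b : RG.DualBasis e I)

theorem src_inv_deg_eq_tgt_iff {i : I} {f : Γ} : G.src (G.inv (b.deg i)) = f ↔ i ∈ b.t f := by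
  rw [G.src_inv, b.mem_t]

theorem y_mul_eq_zero {γ : Γ} {a : R} (ha : a ∈ RG.grade γ) {i : I} (hi : i ∉ b.t (G.tgt γ)) :
    b.y i * a = 0 :=
  RG.mul_ne _ _ (fun h => hi (b.src_inv_deg_eq_tgt_iff.mp h)) _ _ (b.y_mem i) ha

theorem mul_x_eq_zero {γ : Γ} {a : R} (ha : a ∈ RG.grade γ) {i : I} (hi : i ∉ b.t (G.src γ)) :
    a * b.x i = 0 :=
  RG.mul_ne _ _ (fun h => hi ((b.mem_t _ _).mpr h.symm)) _ _ ha (b.x_mem i)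

theorem exists_sum_right (a : R) : ∃ s : Finset I, (∀ i ∉ s, a * b.x i = 0) ∧
    ∑ i ∈ s, a * b.x i * b.y i = a := by
  classical
  refine RG.regular.hom_induction (C := fun a => ∃ s : Finset I, (∀ i ∉ s, a * b.x i = 0) ∧
    ∑ i ∈ s, a * b.x i * b.y i = a) a ?_ ⟨∅, by simp⟩ ?_
  · intro γ a ha
    refine ⟨b.t (G.src γ), fun i => b.mul_x_eq_zero ha, ?_⟩
    simp only [mul_assoc]
    rw [← Finset.mul_sum, b.sum_x_mul_y _ (G.isObj_src γ), RG.mul_one' γ a ha]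
  · rintro a a' ⟨s, hs, h⟩ ⟨s', hs', h'⟩
    refine ⟨s ∪ s', fun i hi => ?_, ?_⟩
    · rw [Finset.mem_union, not_or] at hi
      rw [add_mul, hs i hi.1, hs' i hi.2, add_zero]
    · simp only [add_mul, Finset.sum_add_distrib]
      rw [← Finset.sum_subset Finset.subset_union_left fun i _ hi => by rw [hs i hi, zero_mul],
        ← Finset.sum_subset Finset.subset_union_right fun i _ hi => by rw [hs' i hi, zero_mul],
        h, h']

theorem exists_sum_left (a : R) : ∃ s : Finset I, (∀ i ∉ s, b.y i * a = 0) ∧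
    ∑ i ∈ s, b.x i * (b.y i * a) = a := by
  classical
  refine RG.regular.hom_induction (C := fun a => ∃ s : Finset I, (∀ i ∉ s, b.y i * a = 0) ∧
    ∑ i ∈ s, b.x i * (b.y i * a) = a) a ?_ ⟨∅, by simp⟩ ?_
  · intro γ a ha
    refine ⟨b.t (G.tgt γ), fun i => b.y_mul_eq_zero ha, ?_⟩
    simp only [← mul_assoc]
    rw [← Finset.sum_mul, b.sum_x_mul_y _ (G.isObj_tgt γ), RG.one_mul' γ a ha]
  · rintro a a' ⟨s, hs, h⟩ ⟨s', hs', h'⟩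
    refine ⟨s ∪ s', fun i hi => ?_, ?_⟩
    · rw [Finset.mem_union, not_or] at hi
      rw [mul_add, hs i hi.1, hs' i hi.2, add_zero]
    · simp only [mul_add, Finset.sum_add_distrib]
      rw [← Finset.sum_subset Finset.subset_union_left fun i _ hi => by rw [hs i hi, mul_zero],
        ← Finset.sum_subset Finset.subset_union_right fun i _ hi => by rw [hs' i hi, mul_zero],
        h, h']

theorem eq_zero_of_mul_x {a : R} (h : ∀ i, a * b.x i = 0) : a = 0 := by
  obtain ⟨s, -, hs⟩ := b.exists_sum_right a
  rw [← hs, Finset.sum_eq_zero fun i _ => by rw [h i, zero_mul]]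

theorem eq_zero_of_y_mul {a : R} (h : ∀ i, b.y i * a = 0) : a = 0 := by
  obtain ⟨s, -, hs⟩ := b.exists_sum_left a
  rw [← hs, Finset.sum_eq_zero fun i _ => by rw [h i, mul_zero]]

theorem one_mul_y (i : I) : RG.one e * b.y i = b.y i :=
  RG.one_mul_of_tgt ((G.tgt_inv _).trans (b.src_deg i)) (b.y_mem i)

theorem x_mul_one (i : I) : b.x i * RG.one e = b.x i :=
  RG.mul_one_of_src (b.src_deg i) (b.x_mem i)

/-- The matrix entries `y_i r x_j`, as elements of the corner ring. -/
def entry (i j : I) : R →+ RG.corner e where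
  toFun r := ⟨b.y i * r * b.x j, by rw [← mul_assoc, ← mul_assoc, b.one_mul_y],
    by rw [mul_assoc _ (b.x j), b.x_mul_one]⟩
  map_zero' := Subtype.ext (by simp)
  map_add' r s := Subtype.ext (by simp [mul_add, add_mul])

theorem coe_entry (i j : I) (r : R) : (b.entry i j r : R) = b.y i * r * b.x j := rfl

/-- The matrix of an element with respect to a dual basis. -/
noncomputable def matrix : R →+ (I →₀ I →₀ RG.corner e) where
  toFun r := Finsupp.ofSupportFinite
    (fun i => Finsupp.ofSupportFinite (fun j => b.entry i j r) (by
      obtain ⟨s, hs, -⟩ := b.exists_sum_right (b.y i * r)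
      refine s.finite_toSet.subset fun j hj => ?_
      by_contra hjs
      exact hj (Subtype.ext (hs j hjs))))
    (by
      obtain ⟨s, hs, -⟩ := b.exists_sum_left r
      refine s.finite_toSet.subset fun i hi => ?_
      by_contra his
      refine hi (Finsupp.ext fun j => Subtype.ext ?_)
      change b.y i * r * b.x j = 0
      rw [hs i his, zero_mul])
  map_zero' := Finsupp.ext fun i => Finsupp.ext fun j => map_zero (b.entry i j)
  map_add' r s := Finsupp.ext fun i => Finsupp.ext fun j => map_add (b.entry i j) r s

theorem matrix_injective : Function.Injective b.matrix := by
  refine (injective_iff_map_eq_zero _).mpr fun r hr => b.eq_zero_of_y_mul fun i =>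
    b.eq_zero_of_mul_x fun j => ?_
  have : b.matrix r i j = 0 := by rw [hr]; rfl
  exact congrArg Subtype.val this

theorem matrix_mul (r s : R) (i j : I) :
    b.matrix (r * s) i j = matMulEntry (b.matrix r) (b.matrix s) i j := by
  classical
  obtain ⟨t, ht, hsum⟩ := b.exists_sum_right (b.y i * r)
  rw [matMulEntry, Finsupp.sum_of_support_subset (s := t) _ ?_ _ fun k _ => zero_mul _]
  · refine Subtype.ext ?_
    rw [AddSubmonoidClass.coe_finsetSum]
    change b.y i * (r * s) * b.x j = ∑ k ∈ t, b.y i * r * b.x k * (b.y k * s * b.x j)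
    conv_lhs => rw [← mul_assoc, ← hsum, Finset.sum_mul, Finset.sum_mul]
    exact Finset.sum_congr rfl fun k _ => by simp only [mul_assoc]
  · intro k hk
    by_contra hkt
    exact (Finsupp.mem_support_iff.mp hk) (Subtype.ext (ht k hkt))

theorem y_mul_sum (s s' : Finset I) (m : I → I → R) {k : I} (hm : ∀ j, RG.one e * m k j = m k j)
    (hk : k ∈ s) : b.y k * ∑ i ∈ s, ∑ j ∈ s', b.x i * m i j * b.y j
      = ∑ j ∈ s', m k j * b.y j := by
  rw [Finset.mul_sum, Finset.sum_eq_single_of_mem k hk]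
  · rw [Finset.mul_sum]
    exact Finset.sum_congr rfl fun j _ => by
      rw [← mul_assoc, ← mul_assoc, b.y_mul_x_self, hm]
  · intro i _ hik
    rw [Finset.mul_sum]
    exact Finset.sum_eq_zero fun j _ => by
      rw [← mul_assoc, ← mul_assoc, b.y_mul_x_ne k i hik.symm, zero_mul, zero_mul]

theorem sum_mul_x (s : Finset I) (m : I → R) {k : I} (hm : m k * RG.one e = m k)
    (hk : k ∈ s) : (∑ j ∈ s, m j * b.y j) * b.x k = m k := by
  rw [Finset.sum_mul, Finset.sum_eq_single_of_mem k hk]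
  · rw [mul_assoc, b.y_mul_x_self, hm]
  · intro i _ hik
    rw [mul_assoc, b.y_mul_x_ne i k hik, mul_zero]

theorem grRepMatrix (he : G.IsObj e) :
    RG.GrRepMatrix (RG.cornerRing he) fun i => G.inv (b.deg i) := by
  refine ⟨b.matrix, b.matrix_injective, b.matrix_mul, fun γ => Set.Subset.antisymm ?_ ?_⟩
  · rintro _ ⟨r, hr, rfl⟩ i j
    change b.entry i j r ∈ _
    by_cases h : G.src (G.inv (b.deg i)) = G.tgt γ ∧ G.src γ = G.src (G.inv (b.deg j))
    · have h₂ : G.src (G.comp (G.inv (b.deg i)) γ h.1) = G.tgt (G.inv (G.inv (b.deg j))) := by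
        rw [G.src_comp, h.2, G.tgt_inv]
      have h₃ : G.src (G.comp (G.inv (b.deg i)) γ h.1) = G.tgt (b.deg j) := by
        rw [h₂, G.inv_inv]
      rw [entryGrade_eq_grade (σ := fun i => G.inv (b.deg i)) (γ := γ) (i := i) (j := j)
        (RG.cornerRing he) h.1 h₂]
      have := RG.mul_mem _ _ h₃ _ _ (RG.mul_mem _ _ h.1 _ _ (b.y_mem i) hr) (b.x_mem j)
      rw [G.comp_congr rfl (G.inv_inv (b.deg j)).symm] at this
      exact this
    · rw [entryGrade_eq_bot (σ := fun i => G.inv (b.deg i)) (γ := γ) (i := i) (j := j)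
        (RG.cornerRing he) h]
      refine Subtype.ext ?_
      rw [coe_entry]
      by_cases h₁ : G.src (G.inv (b.deg i)) = G.tgt γ
      · rw [mul_assoc, b.mul_x_eq_zero hr fun hj => h ⟨h₁, ?_⟩, mul_zero]
        · rfl
        · rw [← b.src_inv_deg_eq_tgt_iff] at hj
          exact hj.symm
      · rw [b.y_mul_eq_zero hr fun hi => h₁ (b.src_inv_deg_eq_tgt_iff.mpr hi), zero_mul]
        rfl
  · intro m hm
    have hbot : ∀ i j, ¬ (i ∈ b.t (G.tgt γ) ∧ j ∈ b.t (G.src γ)) → m i j = 0 := fun i j h => by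
      have := hm i j
      rw [entryGrade_eq_bot] at this
      · exact this
      · rintro ⟨h₁, h₂⟩
        exact h ⟨b.src_inv_deg_eq_tgt_iff.mp h₁, b.src_inv_deg_eq_tgt_iff.mp h₂.symm⟩
    have hmem : ∑ i ∈ b.t (G.tgt γ), ∑ j ∈ b.t (G.src γ), b.x i * (m i j : R) * b.y j
        ∈ RG.grade γ := by
      refine AddSubgroup.sum_mem _ fun i hi => AddSubgroup.sum_mem _ fun j hj => ?_
      have h₁ := b.src_inv_deg_eq_tgt_iff.mpr hi
      have h₂ : G.src (G.comp (G.inv (b.deg i)) γ h₁) = G.tgt (G.inv (G.inv (b.deg j))) := by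
        rw [G.src_comp, G.tgt_inv, b.src_inv_deg_eq_tgt_iff.mpr hj]
      have hmij := hm i j
      rw [entryGrade_eq_grade (σ := fun i => G.inv (b.deg i)) (γ := γ) (i := i) (j := j)
        (RG.cornerRing he) h₁ h₂, G.comp_assoc _ _ _ _ (by
        rw [← h₂, G.src_comp])] at hmij
      have h₄ : G.src γ = G.tgt (G.inv (G.inv (b.deg j))) := by rw [← h₂, G.src_comp]
      have h₅ : G.src (G.inv (b.deg i)) = G.tgt (G.comp γ _ h₄) := by rw [G.tgt_comp, h₁]
      have h₆ : G.src (b.deg i) = G.tgt (G.comp (G.inv (b.deg i)) (G.comp γ _ h₄) h₅) := by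
        rw [G.tgt_comp, G.tgt_inv]
      have h₇ : G.src (G.comp γ _ h₄) = G.tgt (G.inv (b.deg j)) := by
        rw [G.src_comp, G.src_inv]
      have := RG.mul_mem _ _ h₆ _ _ (b.x_mem i) hmij
      rw [G.inv_comp_cancel'] at this
      have := RG.mul_mem _ _ h₇ _ _ this (b.y_mem j)
      rwa [G.comp_inv_cancel] at this
    refine ⟨_, hmem, Finsupp.ext fun k => Finsupp.ext fun l => Subtype.ext ?_⟩
    change b.y k * _ * b.x l = _
    by_cases hk : k ∈ b.t (G.tgt γ)
    · by_cases hl : l ∈ b.t (G.src γ)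
      · rw [b.y_mul_sum _ _ (fun i j => (m i j : R)) (fun j => (m k j).2.1) hk,
          b.sum_mul_x _ (fun j => (m k j : R)) (m k l).2.2 hl]
      · rw [hbot k l fun h => hl h.2, mul_assoc, b.mul_x_eq_zero hmem hl, mul_zero]
        rfl
    · rw [hbot k l fun h => hk h.1, b.y_mul_eq_zero hmem hk, zero_mul]
      rfl

theorem dFiniteSeq : DFiniteSeq G e fun i => G.inv (b.deg i) :=
  ⟨fun i => (G.tgt_inv _).trans (b.src_deg i), fun f => (b.t f).finite_toSet.subset fun _ hi =>
    b.src_inv_deg_eq_tgt_iff.mp hi⟩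

theorem existsUnique (he : G.IsObj e) (hS : RG.regular.IsGrSimpleSub (RG.regular.eComp e)) :
    ∃! i, G.src (G.inv (b.deg i)) = e := by
  have h1 := RG.one_ne_zero_of_isGrSimpleSub he hS
  obtain ⟨i, hi⟩ : (b.t e).Nonempty := by
    by_contra h
    rw [Finset.not_nonempty_iff_eq_empty] at h
    have := b.sum_x_mul_y e he
    rw [h, Finset.sum_empty] at this
    exact h1 this.symm
  have hmem : ∀ j ∈ b.t e, b.x j ∈ RG.regular.eComp e := fun j hj =>
    (RG.mem_eComp_iff he).mpr (RG.one_mul_of_tgt ((b.mem_t _ _).mp hj) (b.x_mem j))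
  have hne : ∀ j, b.x j ≠ 0 := fun j h0 => h1 (by rw [← b.y_mul_x_self j, h0, mul_zero])
  refine ⟨i, b.src_inv_deg_eq_tgt_iff.mpr hi, fun j hj => ?_⟩
  by_contra hji
  rcases hS.2.2 ((⊤ : AddSubgroup R).map (RG.regular.orbitHom (b.x i)))
    (RG.regular.isGradedSub_map_orbitHom (b.x_mem i) RG.regular.isGradedSub_top) (by
      rintro _ ⟨a, -, rfl⟩
      exact (RG.isGradedSub_eComp he).1 _ (hmem i hi) a) with h | h
  · have : b.x i * RG.one e ∈ (⊤ : AddSubgroup R).map (RG.regular.orbitHom (b.x i)) :=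
      ⟨_, trivial, rfl⟩
    rw [h, b.x_mul_one] at this
    exact hne i this
  · have := hmem j (b.src_inv_deg_eq_tgt_iff.mp hj)
    rw [← h] at this
    obtain ⟨a, -, ha⟩ := this
    change b.x i * a = b.x j at ha
    refine h1 ?_
    rw [← b.y_mul_x_self j, ← ha, ← mul_assoc, b.y_mul_x_ne j i hji, zero_mul]

end GammaRing.DualBasis

namespace GammaRing

variable {Γ : Type u} {G : Gpd Γ} {D : Type x} [NonUnitalRing D] {DG : GammaRing G D} {e₀ : Γ}

theorem SuppLE.src_tgt_eq (hD : DG.SuppLE e₀) {δ : Γ} {d : D} (hd : d ∈ DG.grade δ)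
    (h0 : d ≠ 0) : G.src δ = e₀ ∧ G.tgt δ = e₀ :=
  hD δ fun h => h0 (by rwa [h, AddSubgroup.mem_bot] at hd)

theorem SuppLE.one_mul (hD : DG.SuppLE e₀) (d : D) : DG.one e₀ * d = d := by
  refine DG.regular.hom_induction (C := fun d => DG.one e₀ * d = d) d (fun δ d hd => ?_)
    (mul_zero _) fun d d' h h' => by rw [mul_add, h, h']
  by_cases h0 : d = 0
  · rw [h0, mul_zero]
  · exact DG.one_mul_of_tgt (hD.src_tgt_eq hd h0).2 hd

end GammaRing

section MatMulEntry

variable {I : Type w} {D : Type x} [NonUnitalRing D]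

theorem matMulEntry_single_left (i j : I) (d : D) (B : I →₀ I →₀ D) (k l : I) :
    matMulEntry (Finsupp.single i (Finsupp.single j d)) B k l
      = Finsupp.single i (d * B j l) k := by
  classical
  rw [matMulEntry, Finsupp.single_apply, Finsupp.single_apply]
  split_ifs
  · rw [Finsupp.sum_single_index (zero_mul _)]
  · rfl

theorem matMulEntry_single_right (A : I →₀ I →₀ D) (i j : I) (d : D) (k l : I) :
    matMulEntry A (Finsupp.single i (Finsupp.single j d)) k l
      = Finsupp.single j (A k i * d) l := by
  classical
  rw [matMulEntry, Finsupp.sum, Finset.sum_eq_single i]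
  · rw [Finsupp.single_eq_same, Finsupp.single_apply, Finsupp.single_apply]
    split_ifs
    · rfl
    · exact mul_zero _
  · intro m _ hm
    rw [Finsupp.single_eq_of_ne hm, Finsupp.zero_apply, mul_zero]
  · intro hi
    rw [Finsupp.notMem_support_iff.mp hi, zero_mul]

end MatMulEntry

namespace GammaRing

variable {Γ : Type u} {G : Gpd Γ} {R : Type v} [NonUnitalRing R] {RG : GammaRing G R}
  {D : Type x} [NonUnitalRing D] {DG : GammaRing G D} {I : Type w} {σ : I → Γ} {e₀ : Γ}
  {φ : R →+ (I →₀ I →₀ D)}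

theorem exists_eq_single (hD : DG.SuppLE e₀) (hσ : ∀ i, G.tgt (σ i) = e₀)
    (hφ : ∀ γ : Γ, (fun r : R => φ r) '' (RG.grade γ : Set R)
      = {m : I →₀ I →₀ D | ∀ i j : I, m i j ∈ entryGrade G DG σ γ i j})
    (i j : I) (d : D) : ∃ r : R, RG.one (G.src (σ i)) * r = r ∧
      φ r = Finsupp.single i (Finsupp.single j d) := by
  classical
  refine DG.regular.hom_induction (C := fun d => ∃ r : R, RG.one (G.src (σ i)) * r = r ∧
      φ r = Finsupp.single i (Finsupp.single j d)) d (fun δ d hd => ?_)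
    ⟨0, mul_zero _, by simp⟩ ?_
  · by_cases h0 : d = 0
    · exact ⟨0, mul_zero _, by simp [h0]⟩
    obtain ⟨hs, ht⟩ := hD.src_tgt_eq hd h0
    have h₁ : G.src δ = G.tgt (σ j) := by rw [hs, hσ]
    have h₂ : G.src (G.inv (σ i)) = G.tgt (G.comp δ (σ j) h₁) := by
      rw [G.src_inv, G.tgt_comp, hσ, ht]
    have hm : Finsupp.single i (Finsupp.single j d) ∈ {m : I →₀ I →₀ D | ∀ k l : I,
        m k l ∈ entryGrade G DG σ (G.comp (G.inv (σ i)) (G.comp δ (σ j) h₁) h₂) k l} := by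
      intro k l
      by_cases hk : i = k
      · subst hk
        by_cases hl : j = l
        · subst hl
          have h₃ : G.src (σ i) = G.tgt (G.comp (G.inv (σ i)) (G.comp δ (σ j) h₁) h₂) := by
            rw [G.tgt_comp, G.tgt_inv]
          have h₄ : G.src (G.comp (σ i) _ h₃) = G.tgt (G.inv (σ j)) := by
            rw [G.src_comp, G.src_comp, G.src_comp, G.tgt_inv]
          rw [entryGrade_eq_grade DG h₃ h₄, Finsupp.single_eq_same, Finsupp.single_eq_same,
            G.comp_congr (G.inv_comp_cancel' _ _) rfl, G.comp_inv_cancel']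
          exact hd
        · rw [Finsupp.single_eq_same, Finsupp.single_eq_of_ne (Ne.symm hl)]
          exact AddSubgroup.zero_mem _
      · rw [Finsupp.single_eq_of_ne (Ne.symm hk)]
        exact AddSubgroup.zero_mem _
    rw [← hφ] at hm
    obtain ⟨r, hr, hrφ⟩ := hm
    exact ⟨r, RG.one_mul_of_tgt (by rw [G.tgt_comp, G.tgt_inv]) hr, hrφ⟩
  · rintro d d' ⟨r, hr, h⟩ ⟨r', hr', h'⟩
    exact ⟨r + r', by rw [mul_add, hr, hr'], by
      rw [map_add, h, h', Finsupp.single_add, Finsupp.single_add]⟩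

theorem exists_entry_inv (hDiv : DG.IsGrDivision) (hD : DG.SuppLE e₀)
    (hinj : Function.Injective φ)
    (hφ : ∀ γ : Γ, (fun r : R => φ r) '' (RG.grade γ : Set R)
      = {m : I →₀ I →₀ D | ∀ i j : I, m i j ∈ entryGrade G DG σ γ i j})
    {γ : Γ} {r : R} (hr : r ∈ RG.grade γ) (hr0 : r ≠ 0) :
    ∃ i j d, φ r i j ≠ 0 ∧ φ r i j * d = DG.one e₀ ∧ d * φ r i j = DG.one e₀ := by
  obtain ⟨i, j, hij⟩ : ∃ i j, φ r i j ≠ 0 := by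
    by_contra! h
    exact hr0 (hinj ((Finsupp.ext fun i => Finsupp.ext fun j => h i j).trans (map_zero φ).symm))
  have hm : φ r i j ∈ entryGrade G DG σ γ i j := by
    have : φ r ∈ (fun r : R => φ r) '' (RG.grade γ : Set R) := ⟨r, hr, rfl⟩
    rw [hφ] at this
    exact this i j
  rw [entryGrade] at hm
  cases hc : G.conj? (σ i) γ (σ j) with
  | none =>
    rw [hc] at hm
    exact absurd (AddSubgroup.mem_bot.mp hm) hij
  | some δ =>
    rw [hc] at hm
    obtain ⟨d, -, h₁, h₂⟩ := hDiv.2 δ _ hm hij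
    obtain ⟨hs, ht⟩ := hD.src_tgt_eq hm hij
    exact ⟨i, j, d, hij, by rw [h₁, ht], by rw [h₂, hs]⟩

theorem apply_eq_zero_of_mem_eComp
    (hφ : ∀ γ : Γ, (fun r : R => φ r) '' (RG.grade γ : Set R)
      = {m : I →₀ I →₀ D | ∀ i j : I, m i j ∈ entryGrade G DG σ γ i j})
    {e : Γ} {i : I} (hi : G.src (σ i) ≠ e) {r : R} (hr : r ∈ RG.regular.eComp e) :
    φ r i = 0 := by
  have hle : RG.regular.eComp e ≤ ((Finsupp.applyAddHom i).comp φ).ker := by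
    refine iSup₂_le fun γ hγ s hs => Finsupp.ext fun j => ?_
    have : φ s ∈ (fun r : R => φ r) '' (RG.grade γ : Set R) := ⟨s, hs, rfl⟩
    rw [hφ] at this
    have := this i j
    rwa [entryGrade_eq_bot DG fun h => hi (h.1.trans hγ)] at this
  exact hle hr

theorem isGrSimpleSub_of_grRepMatrix {e : Γ} (he : G.IsObj e) (hDiv : DG.IsGrDivision)
    (hD : DG.SuppLE e₀) (hσ : ∀ i, G.tgt (σ i) = e₀) (h : RG.GrRepMatrix DG σ)
    (hi : ∃! i, G.src (σ i) = e) : RG.regular.IsGrSimpleSub (RG.regular.eComp e) := by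
  obtain ⟨φ, hinj, hmul, hφ⟩ := h
  obtain ⟨i₀, hi₀, huniq⟩ := hi
  have hrow : ∀ r ∈ RG.regular.eComp e, φ r = Finsupp.single i₀ (φ r i₀) := fun r hr => by
    ext1 k
    by_cases hk : k = i₀
    · rw [hk, Finsupp.single_eq_same]
    · rw [Finsupp.single_eq_of_ne hk]
      exact apply_eq_zero_of_mem_eComp hφ (fun h => hk (huniq k h)) hr
  refine ⟨RG.isGradedSub_eComp he, fun hbot => ?_, fun P hP hPe => or_iff_not_imp_left.mpr
    fun hP0 => le_antisymm hPe fun s hs => ?_⟩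
  · obtain ⟨d, hd⟩ := hDiv.1
    obtain ⟨r, hr, hrφ⟩ := exists_eq_single hD hσ hφ i₀ i₀ d
    rw [hi₀, ← RG.mem_eComp_iff he, hbot, AddSubgroup.mem_bot] at hr
    rw [hr, map_zero, eq_comm, Finsupp.single_eq_zero, Finsupp.single_eq_zero] at hrφ
    exact hd hrφ
  · obtain ⟨γ, r, hrγ, hrP, hr0⟩ := RG.regular.exists_hom_ne_zero hP.2 hP0
    obtain ⟨i, j, b, hij, hb, -⟩ := exists_entry_inv hDiv hD hinj hφ hrγ hr0
    obtain rfl : i = i₀ := by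
      by_contra hne
      rw [hrow r (hPe hrP), Finsupp.single_eq_of_ne hne] at hij
      exact hij rfl
    have hmem : ∀ v : I →₀ D, Finsupp.single i v ∈ P.map φ := fun v => by
      induction v using Finsupp.induction_linear with
      | zero =>
        rw [Finsupp.single_zero]
        exact AddSubgroup.zero_mem _
      | add v w hv hw =>
        rw [Finsupp.single_add]
        exact AddSubgroup.add_mem _ hv hw
      | single l d =>
        obtain ⟨s, -, hs⟩ := exists_eq_single hD hσ hφ j l (b * d)
        have hrs : r * s ∈ P := hP.1 r hrP s
        refine ⟨r * s, hrs, Finsupp.ext fun k => Finsupp.ext fun m => ?_⟩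
        by_cases hk : k = i
        · rw [hmul, hs, matMulEntry_single_right, hk, ← mul_assoc, hb, hD.one_mul,
            Finsupp.single_eq_same]
        · rw [hrow _ (hPe hrs), Finsupp.single_eq_of_ne hk, Finsupp.single_eq_of_ne hk]
    rw [← AddSubgroup.mem_map_iff_mem hinj, hrow s hs]
    exact hmem _

theorem isGrSimpleRing_of_grRepMatrix [Nonempty I] (hDiv : DG.IsGrDivision)
    (hD : DG.SuppLE e₀) (hσ : ∀ i, G.tgt (σ i) = e₀) (h : RG.GrRepMatrix DG σ) :
    RG.IsGrSimpleRing := by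
  obtain ⟨φ, hinj, hmul, hφ⟩ := h
  refine ⟨?_, fun J hJ => or_iff_not_imp_left.mpr fun hJ0 => eq_top_iff.mpr fun s _ => ?_⟩
  · obtain ⟨d, hd⟩ := hDiv.1
    obtain ⟨i⟩ := ‹Nonempty I›
    obtain ⟨r, -, hr⟩ := exists_eq_single hD hσ hφ i i d
    refine ⟨r, fun h0 => hd ?_⟩
    rwa [h0, map_zero, eq_comm, Finsupp.single_eq_zero, Finsupp.single_eq_zero] at hr
  · obtain ⟨γ, r, hrγ, hrJ, hr0⟩ :=
      RG.regular.exists_hom_ne_zero hJ.2 hJ0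
    obtain ⟨i, j, b, -, -, hb⟩ := exists_entry_inv hDiv hD hinj hφ hrγ hr0
    have hmem : ∀ A : I →₀ I →₀ D, A ∈ J.map φ := fun A => by
      induction A using Finsupp.induction_linear with
      | zero => exact AddSubgroup.zero_mem _
      | add A B hA hB => exact AddSubgroup.add_mem _ hA hB
      | single k v =>
        induction v using Finsupp.induction_linear with
        | zero =>
          rw [Finsupp.single_zero]
          exact AddSubgroup.zero_mem _
        | add v w hv hw =>
          rw [Finsupp.single_add]
          exact AddSubgroup.add_mem _ hv hw
        | single l d =>
          obtain ⟨p, -, hp⟩ := exists_eq_single hD hσ hφ k i b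
          obtain ⟨q, -, hq⟩ := exists_eq_single hD hσ hφ j l d
          refine ⟨p * r * q, (hJ.1 _ (hJ.1 r hrJ p).2 q).1,
            Finsupp.ext fun m => Finsupp.ext fun n => ?_⟩
          rw [hmul, hq, matMulEntry_single_right, hmul, hp, matMulEntry_single_left, hb]
          by_cases hm : m = k
          · rw [hm, Finsupp.single_eq_same, Finsupp.single_eq_same, hD.one_mul]
          · rw [Finsupp.single_eq_of_ne hm, Finsupp.single_eq_of_ne hm, zero_mul,
              Finsupp.single_zero]
    exact (AddSubgroup.mem_map_iff_mem hinj).mp (hmem (φ s))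

end GammaRing

/-- characterization of gr-simple pfm rings.
For an object unital `Γ`-graded ring `R` the following are equivalent:
(1) `R` is a gr-simple pfm ring;
(2) `R` is a gr-prime pfm ring;
(3) `R ≅_gr M_I(D)(σ̄)` for a graded division ring `D` with `supp D ⊆ e₀Γe₀`,
    a nonempty `I` and a `d`-finite sequence `σ̄` of elements of `e₀Γ` with
    exactly one `i ∈ I` such that `d(σ_i) = e`;
(4) `R` is gr-simple and some `R(e)` is a gr-simple right `R`-module;
(5) `R` is a gr-simple `Γ₀`-artinian ring and some `R_e` is a division ring. -/
theorem grSimple_pfm_ring_tfae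
    {Γ : Type u} (G : Gpd Γ) {R : Type v} [NonUnitalRing R] (RG : GammaRing G R) :
    [RG.IsGrSimpleRing ∧ GammaRing.IsPfm.{u, v, v} RG,
     RG.IsGrPrime ∧ GammaRing.IsPfm.{u, v, v} RG,
     ∃ (e₀ e : Γ) (D : BRing.{u, v} G) (I : Type v) (σ : I → Γ),
       G.IsObj e₀ ∧ G.IsObj e ∧ Nonempty I ∧ D.str.IsGrDivision ∧ D.str.SuppLE e₀ ∧
         DFiniteSeq G e₀ σ ∧ RG.GrRepMatrix D.str σ ∧ (∃! i : I, G.src (σ i) = e),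
     RG.IsGrSimpleRing ∧
       ∃ e : Γ, G.IsObj e ∧ RG.regular.IsGrSimpleSub (RG.regular.eComp e),
     RG.IsGrSimpleRing ∧ RG.IsRightGamma0Artinian ∧
       ∃ e : Γ, G.IsObj e ∧ RG.ComponentDivisionRing e].TFAE := by
  tfae_have 1 → 2 := fun h => ⟨h.1.isGrPrime, h.2⟩
  tfae_have 2 → 4 := fun h => by
    obtain ⟨e, he, hS⟩ := h.2.exists_isGrSimpleSub_eComp h.1.1
    exact ⟨h.1.isGrSimpleRing h.2 he hS, e, he, hS⟩
  tfae_have 4 → 1 := fun ⟨hR, _, he, hS⟩ =>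
    ⟨hR, fun S => S.str.pseudoFree_of_isGrSimpleSub he hR hS⟩
  tfae_have 4 → 5 := fun ⟨hR, e, he, hS⟩ =>
    ⟨hR, RG.isRightGamma0Artinian_of_isGrSimpleSub he hR hS, e, he,
      RG.componentDivisionRing_of_isGrSimpleSub he hS⟩
  tfae_have 5 → 4 := fun ⟨hR, hA, e, he, hD⟩ =>
    ⟨hR, e, he, RG.isGrSimpleSub_of_componentDivisionRing hR hA he hD⟩
  tfae_have 4 → 3 := fun ⟨hR, e, he, hS⟩ => by
    obtain ⟨I, ⟨b⟩⟩ := RG.exists_dualBasis he hR hS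
    have hi := b.existsUnique he hS
    exact ⟨e, e, ⟨RG.corner e, RG.cornerRing he⟩, I, fun i => G.inv (b.deg i), he, he,
      ⟨hi.choose⟩, RG.isGrDivision_cornerRing he hS, RG.suppLE_cornerRing he, b.dFiniteSeq,
      b.grRepMatrix he, hi⟩
  tfae_have 3 → 4 := fun ⟨_, e, _, _, _, _, he, _, hDiv, hD, hσ, h, hi⟩ =>
    ⟨GammaRing.isGrSimpleRing_of_grRepMatrix hDiv hD hσ.1 h, e, he,
      GammaRing.isGrSimpleSub_of_grRepMatrix he hDiv hD hσ.1 h hi⟩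
  tfae_finish
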